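/- Let F/E be a wildly ramified quadratic extension of 2-adic local fields with ramification invariant s, and let χ₂ be any character of E*/N(F*). Let x = diag(π^{λ₁}ε₁, π^{λ₂}ε₂) with λ₁ ≥ λ₂ integers, ε₁, ε₂ ∈ {1, Δ}, and suppose λ₁ − λ₂ ≤ s (so ε₁ = 1). Then L(x, χ*, χ₂, z) = 0 for all z in the domain of absolute convergence of the defining integral. -/

import Mathlib

open MeasureTheory

noncomputable section

/-- The norm map `N(x) = x · x̄` of a quadratic extension with Galois conjugation `conj`. -/
def Nm {F : Type} [Field F] (conj : F →+* F) (x : F) : F := x * conj x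

/-- The trace map `Tr(x) = x + x̄` of a quadratic extension with Galois conjugation `conj`. -/
def TrF {F : Type} [Field F] (conj : F →+* F) (x : F) : F := x + conj x

/-- The ring of integers `O_F = {x : |x|_F ≤ 1}`. -/
def OF {F : Type} (absF : F → ℝ) : Set F := {x | absF x ≤ 1}

/-- The unit group `O_F^* = {x : |x|_F = 1}`. -/
def UF {F : Type} (absF : F → ℝ) : Set F := {x | absF x = 1}

/-- `O_E`, the ring of integers of the base field `E` (the fixed field of the conjugation),
viewed as a subset of `F`. -/
def OE {F : Type} [Field F] (conj : F →+* F) (absF : F → ℝ) : Set F :=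
  {x | conj x = x ∧ absF x ≤ 1}

/-- `O_E^*`, the unit group of `O_E`, viewed as a subset of `F`. -/
def UE {F : Type} [Field F] (conj : F →+* F) (absF : F → ℝ) : Set F :=
  {x | conj x = x ∧ absF x = 1}

/-- The data of a wildly ramified quadratic extension `F/E` of 2-adic local fields:
`F` is a field with a nontrivial Galois involution `conj` (whose fixed field is `E`),
normalized absolute value `absF` (with `|ϖ|_F = q⁻¹`, where `q` is the residue cardinality,
a power of 2), valuation `vF`, uniformizer `ϖ` (so that `π = N(ϖ)` is a uniformizer of `E`),
ramification invariant `s = v_F(ϖ̄·ϖ⁻¹ − 1)` with `0 < s ≤ 2·v_E(2) = v_F(2)`,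
and additive Haar measure `μF` normalized by `μF (O_F) = 1`. -/
structure WildlyRamified (F : Type) [Field F] [MeasurableSpace F]
    (conj : F →+* F) (q : ℕ) (absF : F → ℝ) (vF : F → ℤ) (ϖ : F) (s : ℕ)
    (μF : Measure F) : Prop where
  conj_invol : ∀ x, conj (conj x) = x
  conj_ne_id : conj ≠ RingHom.id F
  conj_abs : ∀ x, absF (conj x) = absF x
  residue_char_two : ∃ k : ℕ, q = 2 ^ (k + 1)
  abs_nonneg : ∀ x, 0 ≤ absF x
  abs_eq_zero : ∀ x, absF x = 0 ↔ x = 0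
  abs_mul : ∀ x y, absF (x * y) = absF x * absF y
  abs_add : ∀ x y, absF (x + y) ≤ max (absF x) (absF y)
  abs_uniformizer : absF ϖ = (q : ℝ)⁻¹
  abs_val : ∀ x, x ≠ 0 → absF x = (q : ℝ) ^ (-(vF x))
  ram_invariant : (s : ℤ) = vF (conj ϖ * ϖ⁻¹ - 1)
  ram_pos : 0 < s
  ram_le : (s : ℤ) ≤ vF (2 : F)
  haar_add : ∀ a : F, Measure.map (fun x => a + x) μF = μF
  haar_smul : ∀ a : F, a ≠ 0 →
    Measure.map (fun x => a * x) μF = (ENNReal.ofReal (absF a))⁻¹ • μF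
  vol_OF : μF (OF absF) = 1

/-- `χ` is the nontrivial character of `E*/N(F*)`: a multiplicative map on `E* = (fixed field
of `conj`)*` with values in `{±1} ⊂ ℂ` that is trivial exactly on the norms `N(F*)`,
extended to `E` by `χ(0) = 0`. -/
structure NontrivialNormCharacter {F : Type} [Field F] (conj : F →+* F) (χ : F → ℂ) :
    Prop where
  map_zero : χ 0 = 0
  map_mul : ∀ x y : F, conj x = x → conj y = y → χ (x * y) = χ x * χ y
  values : ∀ x : F, conj x = x → x ≠ 0 → χ x = 1 ∨ χ x = -1
  eq_one_iff_norm : ∀ x : F, conj x = x → x ≠ 0 →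
    (χ x = 1 ↔ ∃ w : F, w ≠ 0 ∧ x = w * conj w)

/-- `χ` is a character of `E*/N(F*)`: a multiplicative map on `E*` with values in
`{±1} ⊂ ℂ` that is trivial on the norms `N(F*)`, extended to `E` by `χ(0) = 0`.
(Either the trivial character or the nontrivial one.) -/
structure NormCharacter {F : Type} [Field F] (conj : F →+* F) (χ : F → ℂ) : Prop where
  map_zero : χ 0 = 0
  map_mul : ∀ x y : F, conj x = x → conj y = y → χ (x * y) = χ x * χ y
  values : ∀ x : F, conj x = x → x ≠ 0 → χ x = 1 ∨ χ x = -1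
  norm_trivial : ∀ w : F, w ≠ 0 → χ (w * conj w) = 1

open scoped Classical in
/-- The trivial character of `E*/N(F*)`, extended by `0` at `0`. -/
def trivChar {F : Type} [Field F] (a : F) : ℂ := if a = 0 then 0 else 1

/-- 2×2 matrices over `F`. -/
abbrev Mat2 (F : Type) := Matrix (Fin 2) (Fin 2) F

instance {F : Type} [MeasurableSpace F] : MeasurableSpace (Mat2 F) :=
  inferInstanceAs (MeasurableSpace ((Fin 2) → (Fin 2) → F))

/-- Conjugate transpose `A* = Āᵗ` with respect to the Galois conjugation. -/
def ctrans {F : Type} [Field F] (conj : F →+* F) (A : Mat2 F) : Mat2 F :=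
  Matrix.of fun i j => conj (A j i)

/-- `K = GL₂(O_F)`: matrices with entries in `O_F` whose determinant is a unit of `O_F`. -/
def KSet {F : Type} [Field F] (absF : F → ℝ) : Set (Mat2 F) :=
  {k | (∀ i j, absF (k i j) ≤ 1) ∧ absF k.det = 1}

/-- `μK` is the Haar probability measure of the compact group `K = GL₂(O_F)`,
viewed as a measure on 2×2 matrices supported on `K`. -/
structure HaarOnK (F : Type) [Field F] [MeasurableSpace F] (absF : F → ℝ)
    (μK : Measure (Mat2 F)) : Prop where
  vol_K : μK (KSet absF) = 1
  null_outside : μK (KSet absF)ᶜ = 0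
  left_invariant : ∀ g ∈ KSet absF, Measure.map (fun k => g * k) μK = μK
  right_invariant : ∀ g ∈ KSet absF, Measure.map (fun k => k * g) μK = μK

/-- The spherical function
`L(x, χ₁, χ₂, s₁, s₂) = ∫_K χ₁(d₁(k·x))·|d₁(k·x)|_F^{s₁}·χ₂(d₂(k·x))·|d₂(k·x)|_F^{s₂} dk`,
where `k·x = k x k*`, `d₁(y) = y₁₁` and `d₂(y) = det y`. -/
def Lsph {F : Type} [Field F] [MeasurableSpace F] (conj : F →+* F) (absF : F → ℝ)
    (μK : Measure (Mat2 F)) (χ₁ χ₂ : F → ℂ) (x : Mat2 F) (s₁ s₂ : ℂ) : ℂ :=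
  ∫ k in KSet absF,
    χ₁ ((k * x * ctrans conj k) 0 0)
      * ((absF ((k * x * ctrans conj k) 0 0) : ℂ)) ^ s₁
      * χ₂ ((k * x * ctrans conj k).det)
      * ((absF ((k * x * ctrans conj k).det) : ℂ)) ^ s₂ ∂μK

/-- A multiplicative nonarchimedean absolute value. -/
structure IsNonarchAbs {F : Type} [Field F] (a : F → ℝ) : Prop where
  nonneg : ∀ x, 0 ≤ a x
  eq_zero : ∀ x, a x = 0 ↔ x = 0
  mul : ∀ x y, a (x * y) = a x * a y
  add : ∀ x y, a (x + y) ≤ max (a x) (a y)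

namespace IsNonarchAbs

variable {F : Type} [Field F] {a : F → ℝ}

lemma map_zero (h : IsNonarchAbs a) : a 0 = 0 := (h.eq_zero 0).2 rfl

lemma pos (h : IsNonarchAbs a) {x : F} (hx : x ≠ 0) : 0 < a x :=
  lt_of_le_of_ne (h.nonneg x) fun e => hx ((h.eq_zero x).1 e.symm)

lemma map_one (h : IsNonarchAbs a) : a 1 = 1 := by
  have h1 := h.mul 1 1
  have h2 := h.pos (one_ne_zero (α := F))
  rw [mul_one] at h1
  nlinarith

/-- The absolute value as a homomorphism of monoids with zero. -/
def toHom (h : IsNonarchAbs a) : F →*₀ ℝ where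
  toFun := a
  map_zero' := h.map_zero
  map_one' := h.map_one
  map_mul' := h.mul

lemma map_div (h : IsNonarchAbs a) (x y : F) : a (x / y) = a x / a y := map_div₀ h.toHom x y

lemma map_pow (h : IsNonarchAbs a) (x : F) (n : ℕ) : a (x ^ n) = a x ^ n :=
  _root_.map_pow h.toHom x n

lemma map_neg (h : IsNonarchAbs a) (x : F) : a (-x) = a x := by
  have h1 : a (-x) * a (-x) = a x * a x := by rw [← h.mul, ← h.mul, neg_mul_neg]
  exact (mul_self_inj (h.nonneg _) (h.nonneg _)).1 h1

lemma map_sub_comm (h : IsNonarchAbs a) (x y : F) : a (x - y) = a (y - x) := by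
  rw [← h.map_neg, neg_sub]

lemma add_le (h : IsNonarchAbs a) {x y : F} {r : ℝ} (hx : a x ≤ r) (hy : a y ≤ r) :
    a (x + y) ≤ r := (h.add x y).trans (max_le hx hy)

lemma add_lt (h : IsNonarchAbs a) {x y : F} {r : ℝ} (hx : a x < r) (hy : a y < r) :
    a (x + y) < r := (h.add x y).trans_lt (max_lt hx hy)

lemma sub_le (h : IsNonarchAbs a) {x y : F} {r : ℝ} (hx : a x ≤ r) (hy : a y ≤ r) :
    a (x - y) ≤ r := by
  rw [sub_eq_add_neg]; exact h.add_le hx (by rwa [h.map_neg])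

lemma sub_lt (h : IsNonarchAbs a) {x y : F} {r : ℝ} (hx : a x < r) (hy : a y < r) :
    a (x - y) < r := by
  rw [sub_eq_add_neg]; exact h.add_lt hx (by rwa [h.map_neg])

lemma add_eq_left (h : IsNonarchAbs a) {x y : F} (hxy : a y < a x) : a (x + y) = a x := by
  refine le_antisymm (h.add_le le_rfl hxy.le) ?_
  by_contra hc
  push Not at hc
  have := h.sub_lt hc hxy
  simp at this

lemma mul_le_one (h : IsNonarchAbs a) {x y : F} (hx : a x ≤ 1) (hy : a y ≤ 1) :
    a (x * y) ≤ 1 := by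
  rw [h.mul]; exact mul_le_one₀ hx (h.nonneg y) hy

lemma mul_lt_one_left (h : IsNonarchAbs a) {x y : F} (hx : a x < 1) (hy : a y ≤ 1) :
    a (x * y) < 1 := by
  rw [h.mul]
  exact mul_lt_one_of_nonneg_of_lt_one_left (h.nonneg x) hx hy

lemma mul_lt_one_right (h : IsNonarchAbs a) {x y : F} (hx : a x ≤ 1) (hy : a y < 1) :
    a (x * y) < 1 := by
  rw [mul_comm]; exact h.mul_lt_one_left hy hx

/-- Congruence modulo the maximal ideal on the ring of integers. -/
def residueSetoid (h : IsNonarchAbs a) : Setoid {x : F // a x ≤ 1} where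
  r x y := a (x.1 - y.1) < 1
  iseqv :=
    { refl := fun x => by simp [h.map_zero]
      symm := fun {x y} hxy => by rwa [h.map_sub_comm]
      trans := fun {x y z} hxy hyz => by
        have := h.add_lt hxy hyz
        rwa [sub_add_sub_cancel] at this }

/-- The set of residue classes of integers. -/
def Residue (h : IsNonarchAbs a) : Type := Quotient h.residueSetoid

/-- An integer representing a residue class. -/
def rep (h : IsNonarchAbs a) (c : h.Residue) : F := (Quotient.out c).1

lemma rep_le (h : IsNonarchAbs a) (c : h.Residue) : a (h.rep c) ≤ 1 := (Quotient.out c).2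

/-- The residue class of an integer. -/
def res (h : IsNonarchAbs a) (x : F) (hx : a x ≤ 1) : h.Residue :=
  Quotient.mk h.residueSetoid ⟨x, hx⟩

lemma res_eq_iff (h : IsNonarchAbs a) {x y : F} (hx : a x ≤ 1) (hy : a y ≤ 1) :
    h.res x hx = h.res y hy ↔ a (x - y) < 1 := Quotient.eq (r := h.residueSetoid)

lemma res_rep (h : IsNonarchAbs a) (c : h.Residue) : h.res (h.rep c) (h.rep_le c) = c :=
  Quotient.out_eq c

lemma sub_rep_lt (h : IsNonarchAbs a) {x : F} (hx : a x ≤ 1) :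
    a (x - h.rep (h.res x hx)) < 1 :=
  (h.res_eq_iff hx (h.rep_le _)).1 (h.res_rep _).symm

lemma rep_sub_eq_one (h : IsNonarchAbs a) {c d : h.Residue} (hcd : c ≠ d) :
    a (h.rep c - h.rep d) = 1 := by
  refine le_antisymm (h.sub_le (h.rep_le c) (h.rep_le d)) ?_
  by_contra hc
  push Not at hc
  exact hcd (by rw [← h.res_rep c, ← h.res_rep d]; exact (h.res_eq_iff _ _).2 hc)

lemma rep_eq_one (h : IsNonarchAbs a) {c : h.Residue}
    (hc : c ≠ h.res 0 (by simp [h.map_zero])) : a (h.rep c) = 1 := by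
  refine le_antisymm (h.rep_le c) ?_
  by_contra hlt
  push Not at hlt
  exact hc (by rw [← h.res_rep c]; exact (h.res_eq_iff _ _).2 (by simpa using hlt))

end IsNonarchAbs

namespace WildlyRamified

/-- If `y` is a fixed non-norm, then each fixed `x` is a norm up to a factor `y`. -/
lemma norm_or_mul_norm {F : Type} [Field F] {conj : F →+* F} {χ : F → ℂ}
    (hχ : NontrivialNormCharacter conj χ) {x y : F} (hx : conj x = x)
    (hx0 : x ≠ 0) (hy : conj y = y) (hy0 : y ≠ 0) (hyχ : χ y = -1) :
    ∃ w, w ≠ 0 ∧ (x = w * conj w ∨ x * y = w * conj w) := by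
  rcases hχ.values x hx hx0 with h | h
  · obtain ⟨w, hw, e⟩ := (hχ.eq_one_iff_norm x hx hx0).1 h
    exact ⟨w, hw, Or.inl e⟩
  · have h1 : χ (x * y) = 1 := by rw [hχ.map_mul x y hx hy, h, hyχ]; norm_num
    obtain ⟨w, hw, e⟩ := (hχ.eq_one_iff_norm (x * y) (by rw [map_mul, hx, hy])
      (mul_ne_zero hx0 hy0)).1 h1
    exact ⟨w, hw, Or.inr e⟩

end WildlyRamified

section Ramified

variable {F : Type} [Field F] [MeasurableSpace F] {conj : F →+* F} {q : ℕ} {absF : F → ℝ}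
  {vF : F → ℤ} {ϖ : F} {s : ℕ} {μF : Measure F}

namespace WildlyRamified

lemma nonarch (hW : WildlyRamified F conj q absF vF ϖ s μF) : IsNonarchAbs absF :=
  ⟨hW.abs_nonneg, hW.abs_eq_zero, hW.abs_mul, hW.abs_add⟩

lemma one_lt_q (hW : WildlyRamified F conj q absF vF ϖ s μF) : (1 : ℝ) < q := by
  obtain ⟨k, rfl⟩ := hW.residue_char_two
  push_cast
  exact one_lt_pow₀ (by norm_num) (by omega)

lemma unif_pos (hW : WildlyRamified F conj q absF vF ϖ s μF) : 0 < absF ϖ := by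
  rw [hW.abs_uniformizer]; have := hW.one_lt_q; positivity

lemma unif_lt_one (hW : WildlyRamified F conj q absF vF ϖ s μF) : absF ϖ < 1 := by
  rw [hW.abs_uniformizer]; exact inv_lt_one_of_one_lt₀ hW.one_lt_q

lemma unif_ne_zero (hW : WildlyRamified F conj q absF vF ϖ s μF) : ϖ ≠ 0 := by
  intro h
  have := hW.unif_pos
  rw [h, hW.nonarch.map_zero] at this
  exact lt_irrefl _ this

lemma abs_norm (hW : WildlyRamified F conj q absF vF ϖ s μF) (x : F) :
    absF (x * conj x) = absF x ^ 2 := by rw [hW.abs_mul, hW.conj_abs, sq]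

lemma conj_norm (hW : WildlyRamified F conj q absF vF ϖ s μF) (x : F) :
    conj (x * conj x) = x * conj x := by rw [map_mul, hW.conj_invol, mul_comm]

lemma abs_two_lt_one (hW : WildlyRamified F conj q absF vF ϖ s μF) : absF (2 : F) < 1 := by
  by_cases h2 : (2 : F) = 0
  · rw [h2, hW.nonarch.map_zero]; exact one_pos
  · rw [hW.abs_val 2 h2, zpow_neg]
    refine inv_lt_one_of_one_lt₀ (one_lt_zpow₀ hW.one_lt_q ?_)
    have := hW.ram_le
    have := hW.ram_pos
    omega

/-- Absolute values of squares times a uniformizer are never absolute values of squares. -/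
lemma abs_sq_ne (hW : WildlyRamified F conj q absF vF ϖ s μF) {x y : F} (hx : x ≠ 0)
    (hy : y ≠ 0) : absF x ^ 2 ≠ absF ϖ * absF y ^ 2 := by
  intro h
  have hq := hW.one_lt_q
  have hq0 : (q : ℝ) ≠ 0 := by positivity
  rw [hW.abs_val x hx, hW.abs_val y hy, hW.abs_uniformizer, ← zpow_natCast, ← zpow_natCast,
    ← zpow_mul, ← zpow_mul, ← zpow_neg_one, ← zpow_add₀ hq0] at h
  have := zpow_right_injective₀ (by positivity) hq.ne' h
  push_cast at this
  omega

variable {ρ : F} {χ : F → ℂ}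

lemma abs_pi_pow (hW : WildlyRamified F conj q absF vF ϖ s μF) (n : ℕ) :
    absF ((ϖ * conj ϖ) ^ n) = (absF ϖ ^ n) ^ 2 := by
  rw [hW.nonarch.map_pow, hW.abs_norm, ← pow_mul, ← pow_mul, mul_comm]

lemma abs_pi_pow_lt (hW : WildlyRamified F conj q absF vF ϖ s μF) {n : ℕ} (hn : n ≠ 0) :
    absF ((ϖ * conj ϖ) ^ n) < 1 := by
  rw [hW.abs_pi_pow, ← pow_mul]
  exact pow_lt_one₀ hW.unif_pos.le hW.unif_lt_one (by omega)

lemma abs_one_add (hW : WildlyRamified F conj q absF vF ϖ s μF) {x : F} (hx : absF x < 1) :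
    absF (1 + x) = 1 := by
  rw [hW.nonarch.add_eq_left (by rwa [hW.nonarch.map_one]), hW.nonarch.map_one]

lemma abs_delta (hW : WildlyRamified F conj q absF vF ϖ s μF) (hρ : absF ρ ≤ 1) :
    absF (1 + ρ * (ϖ * conj ϖ) ^ s) = 1 :=
  hW.abs_one_add (hW.nonarch.mul_lt_one_right hρ (hW.abs_pi_pow_lt hW.ram_pos.ne'))

lemma conj_pi_pow (hW : WildlyRamified F conj q absF vF ϖ s μF) (n : ℕ) :
    conj ((ϖ * conj ϖ) ^ n) = (ϖ * conj ϖ) ^ n := by rw [map_pow, hW.conj_norm]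

lemma conj_delta (hW : WildlyRamified F conj q absF vF ϖ s μF) (hρ : conj ρ = ρ) :
    conj (1 + ρ * (ϖ * conj ϖ) ^ s) = 1 + ρ * (ϖ * conj ϖ) ^ s := by
  rw [map_add, map_mul, hW.conj_pi_pow, hρ, map_one]

lemma ne_zero_of_abs_eq_one (hW : WildlyRamified F conj q absF vF ϖ s μF) {x : F}
    (hx : absF x = 1) : x ≠ 0 := by
  rintro rfl
  rw [hW.nonarch.map_zero] at hx
  exact zero_ne_one hx

lemma char_delta (hW : WildlyRamified F conj q absF vF ϖ s μF) (hρ : ρ ∈ UE conj absF)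
    (hΔ : ¬ ∃ w : F, w ≠ 0 ∧ 1 + ρ * (ϖ * conj ϖ) ^ s = Nm conj w)
    (hχ : NontrivialNormCharacter conj χ) : χ (1 + ρ * (ϖ * conj ϖ) ^ s) = -1 := by
  have h0 := hW.ne_zero_of_abs_eq_one (hW.abs_delta hρ.2.le)
  refine (hχ.values _ (hW.conj_delta hρ.1) h0).resolve_left fun h => hΔ ?_
  exact (hχ.eq_one_iff_norm _ (hW.conj_delta hρ.1) h0).1 h

lemma exists_abs_eq_sq (hW : WildlyRamified F conj q absF vF ϖ s μF) (hρ : ρ ∈ UE conj absF)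
    (hΔ : ¬ ∃ w : F, w ≠ 0 ∧ 1 + ρ * (ϖ * conj ϖ) ^ s = Nm conj w)
    (hχ : NontrivialNormCharacter conj χ) {x : F} (hx : conj x = x) (hx0 : x ≠ 0) :
    ∃ w, w ≠ 0 ∧ absF x = absF w ^ 2 := by
  have hΔ1 := hW.abs_delta hρ.2.le
  obtain ⟨w, hw, e | e⟩ := norm_or_mul_norm hχ hx hx0 (hW.conj_delta hρ.1)
    (hW.ne_zero_of_abs_eq_one hΔ1) (hW.char_delta hρ hΔ hχ)
  · exact ⟨w, hw, by rw [e, hW.abs_norm]⟩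
  · refine ⟨w, hw, ?_⟩
    rw [← hW.abs_norm, ← e, hW.abs_mul, hΔ1, mul_one]

lemma abs_conj_unif_div (hW : WildlyRamified F conj q absF vF ϖ s μF) (hρ : ρ ∈ UE conj absF)
    (hΔ : ¬ ∃ w : F, w ≠ 0 ∧ 1 + ρ * (ϖ * conj ϖ) ^ s = Nm conj w)
    (hχ : NontrivialNormCharacter conj χ) : absF (conj ϖ * ϖ⁻¹ - 1) = absF ϖ ^ s := by
  have hne : conj ϖ * ϖ⁻¹ - 1 ≠ 0 := by
    intro h
    have hfix : conj ϖ = ϖ := by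
      have := hW.unif_ne_zero
      field_simp at h
      linear_combination h
    obtain ⟨w, hw, e⟩ := hW.exists_abs_eq_sq hρ hΔ hχ hfix hW.unif_ne_zero
    refine hW.abs_sq_ne hw one_ne_zero ?_
    rw [← e, hW.nonarch.map_one]; ring
  rw [hW.abs_val _ hne, ← hW.ram_invariant, hW.abs_uniformizer, inv_pow, zpow_neg, zpow_natCast]

/-- The trace shrinks absolute values by `|ϖ|^s`. -/
lemma abs_trace_le (hW : WildlyRamified F conj q absF vF ϖ s μF) (hρ : ρ ∈ UE conj absF)
    (hΔ : ¬ ∃ w : F, w ≠ 0 ∧ 1 + ρ * (ϖ * conj ϖ) ^ s = Nm conj w)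
    (hχ : NontrivialNormCharacter conj χ) (x : F) :
    absF (x + conj x) ≤ absF ϖ ^ s * absF x := by
  by_contra hlt
  push Not at hlt
  have hT0 : x + conj x ≠ 0 := by
    intro h
    rw [h, hW.nonarch.map_zero] at hlt
    exact absurd hlt (not_lt.2 (mul_nonneg (pow_nonneg hW.unif_pos.le _) (hW.abs_nonneg _)))
  have hu0 := hW.unif_ne_zero
  have e : ϖ * (x + conj x) + conj x * (ϖ * (conj ϖ * ϖ⁻¹ - 1))
      = x * ϖ + conj (x * ϖ) := by
    rw [map_mul]; field_simp; ring
  have habs : absF (x * ϖ + conj (x * ϖ)) = absF ϖ * absF (x + conj x) := by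
    rw [← e, hW.nonarch.add_eq_left, hW.abs_mul]
    rw [hW.abs_mul, hW.abs_mul, hW.abs_mul, hW.abs_conj_unif_div hρ hΔ hχ, hW.conj_abs]
    have := mul_lt_mul_of_pos_left hlt hW.unif_pos
    linarith
  have hfix : ∀ y : F, conj (y + conj y) = y + conj y := fun y => by
    rw [map_add, hW.conj_invol, add_comm]
  obtain ⟨w, hw, hw'⟩ := hW.exists_abs_eq_sq hρ hΔ hχ (hfix x) hT0
  have hT1 : x * ϖ + conj (x * ϖ) ≠ 0 := by
    intro h
    rw [h, hW.nonarch.map_zero] at habs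
    exact absurd habs (mul_pos hW.unif_pos (hW.nonarch.pos hT0)).ne
  obtain ⟨w', hw1, hw1'⟩ := hW.exists_abs_eq_sq hρ hΔ hχ (hfix _) hT1
  exact hW.abs_sq_ne hw1 hw (by rw [← hw1', ← hw', habs])

lemma abs_conj_sub_lt (hW : WildlyRamified F conj q absF vF ϖ s μF) (hρ : ρ ∈ UE conj absF)
    (hΔ : ¬ ∃ w : F, w ≠ 0 ∧ 1 + ρ * (ϖ * conj ϖ) ^ s = Nm conj w)
    (hχ : NontrivialNormCharacter conj χ) {x : F} (hx : absF x ≤ 1) :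
    absF (conj x - x) < 1 := by
  have e : conj x - x = (x + conj x) - 2 * x := by ring
  rw [e]
  refine hW.nonarch.sub_lt ((hW.abs_trace_le hρ hΔ hχ x).trans_lt ?_)
    (hW.nonarch.mul_lt_one_left hW.abs_two_lt_one hx)
  exact mul_lt_one_of_nonneg_of_lt_one_left (pow_nonneg hW.unif_pos.le _)
    (pow_lt_one₀ hW.unif_pos.le hW.unif_lt_one hW.ram_pos.ne') hx

lemma abs_norm_sub_norm_sub_sq_lt (hW : WildlyRamified F conj q absF vF ϖ s μF)
    (hρ : ρ ∈ UE conj absF)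
    (hΔ : ¬ ∃ w : F, w ≠ 0 ∧ 1 + ρ * (ϖ * conj ϖ) ^ s = Nm conj w)
    (hχ : NontrivialNormCharacter conj χ) {x y : F} (hx : absF x ≤ 1) (hy : absF y ≤ 1) :
    absF (x * conj x - y * conj y - (x - y) ^ 2) < 1 := by
  have e : x * conj x - y * conj y - (x - y) ^ 2
      = x * (conj x - x) - y * (conj y - y) + 2 * (y * (x - y)) := by ring
  rw [e]
  have hN := hW.nonarch
  refine hN.add_lt (hN.sub_lt ?_ ?_) ?_
  · exact hN.mul_lt_one_right hx (hW.abs_conj_sub_lt hρ hΔ hχ hx)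
  · exact hN.mul_lt_one_right hy (hW.abs_conj_sub_lt hρ hΔ hχ hy)
  · exact hN.mul_lt_one_left hW.abs_two_lt_one (hN.mul_le_one hy (hN.sub_le hx hy))

/-- `N(1 + ϖ^s y) = 1 + π^s (trace term + N(y))`: the map on residues of this second factor. -/
lemma exists_not_near_defect (hW : WildlyRamified F conj q absF vF ϖ s μF)
    (hρ : ρ ∈ UE conj absF)
    (hΔ : ¬ ∃ w : F, w ≠ 0 ∧ 1 + ρ * (ϖ * conj ϖ) ^ s = Nm conj w)
    (hχ : NontrivialNormCharacter conj χ) (hfin : Finite hW.nonarch.Residue) :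
    ∃ t : F, conj t = t ∧ absF t ≤ 1 ∧ ∀ y, absF y ≤ 1 →
      1 ≤ absF (t - ((ϖ ^ s * y + conj (ϖ ^ s * y)) / (ϖ * conj ϖ) ^ s + y * conj y)) := by
  have hN := hW.nonarch
  set P := (ϖ * conj ϖ) ^ s with hP
  have hPabs : absF P = absF ϖ ^ s * absF ϖ ^ s := by rw [hP, hW.abs_pi_pow, sq]
  have hup : 0 < absF ϖ ^ s := pow_pos hW.unif_pos s
  have hP0 : P ≠ 0 := by
    intro h
    rw [h, hN.map_zero] at hPabs
    exact absurd hPabs (mul_pos hup hup).ne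
  have htr : ∀ y, absF ((ϖ ^ s * y + conj (ϖ ^ s * y)) / P) ≤ absF y := fun y => by
    rw [hN.map_div, div_le_iff₀ (hN.pos hP0), hPabs]
    have := hW.abs_trace_le hρ hΔ hχ (ϖ ^ s * y)
    rw [hW.abs_mul, hN.map_pow] at this
    linarith
  set θ : F → F := fun y => (ϖ ^ s * y + conj (ϖ ^ s * y)) / P + y * conj y with hθ
  have hθ1 : ∀ y, absF y ≤ 1 → absF (θ y) ≤ 1 := fun y hy =>
    hN.add_le ((htr y).trans hy) (hN.mul_le_one hy (by rwa [hW.conj_abs]))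
  have hθd : ∀ x y, absF x ≤ 1 → absF y ≤ 1 → absF (x - y) < 1 → absF (θ x - θ y) < 1 := by
    intro x y hx hy hxy
    have e : θ x - θ y = (ϖ ^ s * (x - y) + conj (ϖ ^ s * (x - y))) / P
        + ((x - y) * conj x + y * conj (x - y)) := by
      simp only [hθ, map_mul, map_sub]; field_simp; ring
    rw [e]
    refine hN.add_lt ((htr _).trans_lt hxy) (hN.add_lt ?_ ?_)
    · exact hN.mul_lt_one_left hxy (by rwa [hW.conj_abs])
    · exact hN.mul_lt_one_right hy (by rwa [hW.conj_abs])
  have hNd : ∀ x y, absF x ≤ 1 → absF y ≤ 1 →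
      (absF (x * conj x - y * conj y) < 1 ↔ absF (x - y) < 1) := by
    intro x y hx hy
    have h1 := hW.abs_norm_sub_norm_sub_sq_lt hρ hΔ hχ hx hy
    have h2 : absF ((x - y) ^ 2) < 1 ↔ absF (x - y) < 1 := by
      rw [hN.map_pow]; exact pow_lt_one_iff_of_nonneg (hW.abs_nonneg _) two_ne_zero
    rw [← h2]
    constructor
    · intro h; have := hN.sub_lt h h1; rwa [sub_sub_cancel] at this
    · intro h; have := hN.add_lt h1 h; rwa [sub_add_cancel] at this
  have hN1 : ∀ y, absF y ≤ 1 → absF (y * conj y) ≤ 1 := fun y hy =>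
    hN.mul_le_one hy (by rwa [hW.conj_abs])
  let f : hN.Residue → hN.Residue := Quotient.map (sa := hN.residueSetoid) (sb := hN.residueSetoid)
    (fun y => ⟨θ y.1, hθ1 y.1 y.2⟩) (fun x y hxy => hθd x.1 y.1 x.2 y.2 hxy)
  let g : hN.Residue → hN.Residue := Quotient.map (sa := hN.residueSetoid) (sb := hN.residueSetoid)
    (fun y => ⟨y.1 * conj y.1, hN1 y.1 y.2⟩) (fun x y hxy => (hNd x.1 y.1 x.2 y.2).2 hxy)
  have hf : ∀ y (hy : absF y ≤ 1), f (hN.res y hy) = hN.res (θ y) (hθ1 y hy) := fun _ _ => rfl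
  have hg : ∀ y (hy : absF y ≤ 1), g (hN.res y hy) = hN.res (y * conj y) (hN1 y hy) :=
    fun _ _ => rfl
  have hgs : Function.Surjective g := by
    refine Finite.injective_iff_surjective.1 fun c d hcd => ?_
    rw [← hN.res_rep c, ← hN.res_rep d, hg, hg, hN.res_eq_iff,
      hNd _ _ (hN.rep_le c) (hN.rep_le d)] at hcd
    rw [← hN.res_rep c, ← hN.res_rep d]
    exact (hN.res_eq_iff _ _).2 hcd
  have hfs : ¬ Function.Surjective f := by
    intro hs
    have hi := Finite.injective_iff_surjective.2 hs
    set y₀ := (conj ϖ * ϖ⁻¹ - 1) / ϖ ^ s with hy₀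
    have hu0 := hW.unif_ne_zero
    have hcu0 : conj ϖ ≠ 0 := by
      intro h; exact hu0 (by rw [← hW.conj_invol ϖ, h, map_zero])
    have hy₀1 : absF y₀ = 1 := by
      rw [hy₀, hN.map_div, hW.abs_conj_unif_div hρ hΔ hχ, hN.map_pow, div_self hup.ne']
    have h0 : absF (0 : F) ≤ 1 := by rw [hN.map_zero]; exact zero_le_one
    have hθy : θ y₀ = θ 0 := by
      have e1 : ϖ ^ s * y₀ = conj ϖ * ϖ⁻¹ - 1 := by rw [hy₀]; field_simp
      have e2 : y₀ * conj y₀ = (ϖ ^ s * y₀) * conj (ϖ ^ s * y₀) / P := by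
        rw [hP, map_mul, map_pow, mul_pow]; field_simp
      simp only [hθ]
      rw [e2, e1]
      simp only [map_sub, map_mul, hW.conj_invol, map_inv₀, map_one, map_zero, mul_zero, add_zero,
        zero_div]
      field_simp
      ring
    have := hi ((hf y₀ hy₀1.le).trans ((by simp only [hθy] :
      hN.res (θ y₀) (hθ1 y₀ hy₀1.le) = hN.res (θ 0) (hθ1 0 h0)).trans (hf 0 h0).symm))
    rw [hN.res_eq_iff, sub_zero, hy₀1] at this
    exact lt_irrefl _ this
  rw [Function.Surjective] at hfs
  push Not at hfs
  obtain ⟨c, hc⟩ := hfs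
  obtain ⟨d, rfl⟩ := hgs c
  refine ⟨hN.rep d * conj (hN.rep d), hW.conj_norm _, hN1 _ (hN.rep_le d), fun y hy => ?_⟩
  by_contra hlt
  push Not at hlt
  refine hc (hN.res y hy) ?_
  conv_rhs => rw [← hN.res_rep d]
  rw [hf, hg, hN.res_eq_iff, hN.map_sub_comm]
  exact hlt

/-- With finite residue field, some fixed element of the form `1 + N(r)π^s/ε` is not a norm. -/
lemma exists_char_eq_neg_one (hW : WildlyRamified F conj q absF vF ϖ s μF)
    (hρ : ρ ∈ UE conj absF)
    (hΔ : ¬ ∃ w : F, w ≠ 0 ∧ 1 + ρ * (ϖ * conj ϖ) ^ s = Nm conj w)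
    (hχ : NontrivialNormCharacter conj χ) (hfin : Finite hW.nonarch.Residue)
    {ε : F} (hε : ε ∈ UE conj absF) :
    ∃ r : F, absF r ≤ 1 ∧ χ (1 + r * conj r * (ϖ * conj ϖ) ^ s / ε) = -1 := by
  have hN := hW.nonarch
  have hΔχ := hW.char_delta hρ hΔ hχ
  have hΔc := hW.conj_delta hρ.1
  have hΔ1 := hW.abs_delta hρ.2.le
  have hPc : conj ((ϖ * conj ϖ) ^ s) = (ϖ * conj ϖ) ^ s := hW.conj_pi_pow s
  have hPabs : absF ((ϖ * conj ϖ) ^ s) = (absF ϖ ^ s) ^ 2 := hW.abs_pi_pow s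
  have hP1 := hW.abs_pi_pow_lt hW.ram_pos.ne'
  have hup : 0 < absF ϖ ^ s := pow_pos hW.unif_pos s
  set P := (ϖ * conj ϖ) ^ s with hP
  set D := 1 + ρ * P with hD
  have hP0 : P ≠ 0 := by
    intro h
    rw [h, hN.map_zero] at hPabs
    exact absurd hPabs (pow_pos hup 2).ne
  have hD0 := hW.ne_zero_of_abs_eq_one hΔ1
  have hε0 := hW.ne_zero_of_abs_eq_one hε.2
  have hρ0 := hW.ne_zero_of_abs_eq_one hρ.2
  have hunit : ∀ w : F, absF (w * conj w) = 1 → absF w ≤ 1 := fun w h => by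
    rw [hW.abs_norm] at h
    exact ((pow_eq_one_iff_of_nonneg (hW.abs_nonneg w) two_ne_zero).1 h).le
  obtain ⟨w, hw0, hw | hw⟩ := norm_or_mul_norm hχ (x := ρ * ε)
    (by rw [map_mul, hρ.1, hε.1]) (mul_ne_zero hρ0 hε0) hΔc hD0 hΔχ
  · refine ⟨w, hunit w (by rw [← hw, hW.abs_mul, hρ.2, hε.2, one_mul]), ?_⟩
    rw [← hw, ← hΔχ]
    congr 1
    rw [hD]; field_simp
  · refine ⟨w, hunit w (by rw [← hw, hW.abs_mul, hW.abs_mul, hρ.2, hε.2, hΔ1]; norm_num), ?_⟩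
    set D' := 1 + ρ ^ 2 * P ^ 2 / D with hD'
    have e : 1 + w * conj w * P / ε = D * D' := by
      rw [← hw, hD']; field_simp; rw [hD]; ring
    have hsm : absF (ρ ^ 2 * P ^ 2 / D) < absF P := by
      rw [hN.map_div, hΔ1, div_one, hW.abs_mul, hN.map_pow, hρ.2, one_pow, one_mul, sq, hW.abs_mul]
      exact mul_lt_of_lt_one_left (hN.pos hP0) hP1
    have hD'1 : absF D' = 1 := hW.abs_one_add (hsm.trans hP1)
    have hD'0 := hW.ne_zero_of_abs_eq_one hD'1
    have hD'c : conj D' = D' := by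
      rw [hD', map_add, map_div₀, map_mul, map_pow, map_pow, hPc, hρ.1, hΔc, map_one]
    rw [e, hχ.map_mul D D' hΔc hD'c, hΔχ]
    rcases hχ.values D' hD'c hD'0 with h | h
    · rw [h]; norm_num
    exfalso
    obtain ⟨t, htc, ht1, ht⟩ := hW.exists_not_near_defect hρ hΔ hχ hfin
    have htP : absF (t * P) < 1 := hN.mul_lt_one_right ht1 hP1
    have h1t := hW.abs_one_add htP
    have hnear : ∃ v, absF (v * conj v - (1 + t * P)) < absF P := by
      obtain ⟨v, _, hv | hv⟩ := norm_or_mul_norm hχ (x := 1 + t * P)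
        (by rw [map_add, map_mul, htc, hPc, map_one]) (hW.ne_zero_of_abs_eq_one h1t) hD'c hD'0 h
      · exact ⟨v, by rw [← hv, sub_self, hN.map_zero]; exact hN.pos hP0⟩
      · refine ⟨v, ?_⟩
        rw [← hv, hD']
        have : (1 + t * P) * (1 + ρ ^ 2 * P ^ 2 / D) - (1 + t * P)
            = (1 + t * P) * (ρ ^ 2 * P ^ 2 / D) := by ring
        rw [this, hW.abs_mul, h1t, one_mul]
        exact hsm
    obtain ⟨v, hv⟩ := hnear
    set x := v - 1 with hx
    have hvx : v = 1 + x := by rw [hx]; ring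
    have e2 : v * conj v - (1 + t * P) = (x * conj x + (x + conj x)) - t * P := by
      rw [hvx, map_add, map_one]; ring
    rw [e2] at hv
    have hle : absF (x * conj x + (x + conj x)) ≤ absF P := by
      have h3 : absF (t * P) ≤ absF P := by
        rw [hW.abs_mul]; exact mul_le_of_le_one_left (hW.abs_nonneg P) ht1
      have := hN.add_le hv.le h3
      rwa [sub_add_cancel] at this
    have hxs : absF x ≤ absF ϖ ^ s := by
      by_contra hlt
      push Not at hlt
      have h4 : absF (x + conj x) < absF (x * conj x) := by
        rw [hW.abs_norm, sq]
        exact (hW.abs_trace_le hρ hΔ hχ x).trans_lt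
          (mul_lt_mul_of_pos_right hlt (hup.trans hlt))
      rw [hN.add_eq_left h4, hW.abs_norm, hPabs] at hle
      exact absurd hle (not_le.2 (pow_lt_pow_left₀ hlt hup.le two_ne_zero))
    have hu0 := hW.unif_ne_zero
    have hy : ϖ ^ s * (x / ϖ ^ s) = x := by field_simp
    have hc := ht (x / ϖ ^ s) (by
      rw [hN.map_div, hN.map_pow]; exact div_le_one_of_le₀ hxs hup.le)
    refine absurd hc (not_le.2 ?_)
    have hcu0 : conj ϖ ≠ 0 := by
      intro h; exact hu0 (by rw [← hW.conj_invol ϖ, h, map_zero])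
    have e3 : t - ((ϖ ^ s * (x / ϖ ^ s) + conj (ϖ ^ s * (x / ϖ ^ s))) / P
        + x / ϖ ^ s * conj (x / ϖ ^ s)) = -((x * conj x + (x + conj x)) - t * P) / P := by
      rw [hy, map_div₀, map_pow]
      have : x / ϖ ^ s * (conj x / conj ϖ ^ s) = x * conj x / P := by
        rw [hP, mul_pow]; field_simp
      rw [this]; field_simp; ring
    rw [e3, hN.map_div, hN.map_neg]
    exact (div_lt_one (hN.pos hP0)).2 hv

end WildlyRamified

end Ramified

section Equidistribution

variable {Ω ι : Type*} [MeasurableSpace Ω] {μ : Measure Ω}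

/-- A family of reals whose finite partial sums grow sublinearly in the number of terms. -/
def SublinearSums (d : ι → ℝ) : Prop :=
  ∀ ε : ℝ, 0 < ε → ∃ C : ℝ, ∀ s : Finset ι, |∑ i ∈ s, d i| ≤ ε * s.card + C

namespace SublinearSums

variable {d e : ι → ℝ}

lemma zero : SublinearSums (fun _ : ι => (0 : ℝ)) := fun ε hε =>
  ⟨0, fun s => by simpa using by positivity⟩

lemma neg (hd : SublinearSums d) : SublinearSums (fun i => -d i) := fun ε hε => by
  obtain ⟨C, hC⟩ := hd ε hε
  exact ⟨C, fun s => by rw [Finset.sum_neg_distrib, abs_neg]; exact hC s⟩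

lemma add (hd : SublinearSums d) (he : SublinearSums e) : SublinearSums (fun i => d i + e i) :=
  fun ε hε => by
    obtain ⟨C, hC⟩ := hd (ε / 2) (half_pos hε)
    obtain ⟨C', hC'⟩ := he (ε / 2) (half_pos hε)
    refine ⟨C + C', fun s => ?_⟩
    rw [Finset.sum_add_distrib]
    have := abs_add_le (∑ i ∈ s, d i) (∑ i ∈ s, e i)
    linarith [hC s, hC' s]

lemma of_approx (h : ∀ ε : ℝ, 0 < ε → ∃ e : ι → ℝ, SublinearSums e ∧ ∀ i, |d i - e i| ≤ ε) :
    SublinearSums d := fun ε hε => by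
  obtain ⟨e, he, hde⟩ := h (ε / 2) (half_pos hε)
  obtain ⟨C, hC⟩ := he (ε / 2) (half_pos hε)
  refine ⟨C, fun s => ?_⟩
  have h1 : ∑ i ∈ s, d i = ∑ i ∈ s, (d i - e i) + ∑ i ∈ s, e i := by
    rw [← Finset.sum_add_distrib]; simp
  have h2 : |∑ i ∈ s, (d i - e i)| ≤ s.card * (ε / 2) := by
    refine (Finset.abs_sum_le_sum_abs _ _).trans ?_
    simpa using Finset.sum_le_card_nsmul s _ _ fun i _ => hde i
  rw [h1]
  have := abs_add_le (∑ i ∈ s, (d i - e i)) (∑ i ∈ s, e i)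
  linarith [hC s]

lemma finite_le (hd : SublinearSums d) {δ : ℝ} (hδ : 0 < δ) : {i | δ ≤ d i}.Finite := by
  by_contra hinf
  obtain ⟨C, hC⟩ := hd (δ / 2) (half_pos hδ)
  obtain ⟨n, hn⟩ := exists_nat_gt (2 * C / δ)
  obtain ⟨s, hs, hcard⟩ := Set.Infinite.exists_subset_card_eq hinf n
  have h1 := (le_abs_self _).trans (hC s)
  have h2 : s.card * δ ≤ ∑ i ∈ s, d i := by
    simpa using Finset.card_nsmul_le_sum s d δ fun i hi => hs hi
  rw [hcard] at h1 h2
  rw [div_lt_iff₀ hδ] at hn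
  linarith

lemma countable_ne_zero (hd : SublinearSums d) : {i | d i ≠ 0}.Countable := by
  have hsub : {i | d i ≠ 0} ⊆ ⋃ n : ℕ, {i | 1 / ((n : ℝ) + 1) ≤ d i} ∪
      {i | 1 / ((n : ℝ) + 1) ≤ -d i} := by
    intro i hi
    obtain ⟨n, hn⟩ := exists_nat_one_div_lt (abs_pos.2 hi)
    refine Set.mem_iUnion.2 ⟨n, ?_⟩
    rcases abs_choice (d i) with h | h <;> rw [h] at hn
    · exact Or.inl hn.le
    · exact Or.inr hn.le
  refine (Set.countable_iUnion fun n => ?_).mono hsub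
  exact ((hd.finite_le (by positivity)).countable).union
    ((hd.neg.finite_le (by positivity)).countable)

end SublinearSums

/-- Families of measures dominated by a common finite measure with the same total masses:
sublinear growth of sums of differences extends from a generating π-system. -/
lemma sublinearSums_measureReal_sub [IsFiniteMeasure μ] {α β : ι → Measure Ω}
    (hα : ∀ i, α i ≤ μ) (hβ : ∀ i, β i ≤ μ)
    (huniv : ∀ i, α i Set.univ = β i Set.univ) {C : Set (Set Ω)}
    (hgen : ‹MeasurableSpace Ω› = MeasurableSpace.generateFrom C) (hpi : IsPiSystem C)
    (hC : ∀ E ∈ C, SublinearSums fun i => (α i).real E - (β i).real E) {E : Set Ω}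
    (hE : MeasurableSet E) : SublinearSums fun i => (α i).real E - (β i).real E := by
  have fα : ∀ i, IsFiniteMeasure (α i) := fun i => isFiniteMeasure_of_le μ (hα i)
  have fβ : ∀ i, IsFiniteMeasure (β i) := fun i => isFiniteMeasure_of_le μ (hβ i)
  induction E, hE using MeasurableSpace.induction_on_inter hgen hpi with
  | empty => simpa using SublinearSums.zero
  | basic t ht => exact hC t ht
  | compl t ht ih =>
    convert ih.neg using 2 with i
    rw [measureReal_compl ht, measureReal_compl ht, measureReal_def (α i) Set.univ, huniv i, ← measureReal_def]
    ring
  | iUnion f hd hm ih =>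
    have hfin : ∀ n : ℕ, SublinearSums fun i =>
        (α i).real (⋃ k ∈ Finset.range n, f k) - (β i).real (⋃ k ∈ Finset.range n, f k) := by
      intro n
      convert (?_ : SublinearSums fun i => ∑ k ∈ Finset.range n,
        ((α i).real (f k) - (β i).real (f k))) using 2 with i
      · rw [Finset.sum_sub_distrib,
          measureReal_biUnion_finset (fun x _ y _ hxy => hd hxy) (fun k _ => hm k),
          measureReal_biUnion_finset (fun x _ y _ hxy => hd hxy) (fun k _ => hm k)]
      · induction n with
        | zero => simpa using SublinearSums.zero
        | succ n ihn => simp only [Finset.sum_range_succ]; exact ihn.add (ih n)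
    refine SublinearSums.of_approx fun ε hε => ?_
    have ht := tendsto_measure_biUnion_Ici_zero_of_pairwise_disjoint (μ := μ)
      (fun n => (hm n).nullMeasurableSet) hd
    have ht' := (ENNReal.tendsto_toReal ENNReal.zero_ne_top).comp ht
    obtain ⟨n, hn⟩ := (ht'.eventually (gt_mem_nhds (by simpa using hε))).exists
    refine ⟨_, hfin n, fun i => ?_⟩
    set T := ⋃ k ∈ Set.Ici n, f k with hT
    set G := ⋃ k ∈ Finset.range n, f k with hG
    have hGm : MeasurableSet G := Finset.measurableSet_biUnion _ fun k _ => hm k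
    have hGs : G ⊆ ⋃ k, f k := Set.iUnion₂_subset fun k _ => Set.subset_iUnion f k
    have hdT : (⋃ k, f k) \ G ⊆ T := by
      rintro x ⟨hx, hxG⟩
      obtain ⟨k, hk⟩ := Set.mem_iUnion.1 hx
      refine Set.mem_iUnion₂.2 ⟨k, ?_, hk⟩
      by_contra hkn
      exact hxG (Set.mem_iUnion₂.2 ⟨k, by simpa using hkn, hk⟩)
    have key : ∀ ν : Measure Ω, ν ≤ μ → 0 ≤ ν.real (⋃ k, f k) - ν.real G ∧
        ν.real (⋃ k, f k) - ν.real G ≤ ε := by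
      intro ν hν
      have : IsFiniteMeasure ν := isFiniteMeasure_of_le μ hν
      rw [← measureReal_sdiff hGs hGm]
      refine ⟨measureReal_nonneg, ?_⟩
      have h1 : ν.real ((⋃ k, f k) \ G) ≤ μ.real T :=
        (measureReal_mono hdT (measure_ne_top ν T)).trans (ENNReal.toReal_mono (measure_ne_top μ T) (hν T))
      exact h1.trans hn.le
    have h1 := key _ (hα i)
    have h2 := key _ (hβ i)
    rw [abs_le]
    constructor <;> linarith [h1.1, h1.2, h2.1, h2.2]

/-- Second moment estimate for two families of events of almost equal pair correlations. -/
lemma abs_sum_measureReal_inter_sub_le [IsProbabilityMeasure μ] (s : Finset ι)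
    {U V : ι → Set Ω} (hU : ∀ i, NullMeasurableSet (U i) μ)
    (hV : ∀ i, NullMeasurableSet (V i) μ) {W : Set Ω} (hW : NullMeasurableSet W μ) {c : ℝ}
    (hUU : ∑ i ∈ s, ∑ j ∈ s, μ.real (U i ∩ U j) ≤ c * s.card ^ 2 + s.card)
    (hVV : ∑ i ∈ s, ∑ j ∈ s, μ.real (V i ∩ V j) ≤ c * s.card ^ 2 + s.card)
    (hUV : c * s.card ^ 2 - s.card ≤ ∑ i ∈ s, ∑ j ∈ s, μ.real (U i ∩ V j))
    {η : ℝ} (hη : 0 < η) :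
    |∑ i ∈ s, (μ.real (U i ∩ W) - μ.real (V i ∩ W))| ≤ 4 * η * s.card + 1 / (4 * η) := by
  set ind : Set Ω → Ω → ℝ := fun S => S.indicator fun _ => 1 with hind
  have hint : ∀ S, NullMeasurableSet S μ → Integrable (ind S) μ := fun S hS =>
    (integrable_const 1).indicator₀ hS
  have hval : ∀ S, NullMeasurableSet S μ → ∫ x, ind S x ∂μ = μ.real S := fun S hS => by
    rw [hind, integral_indicator₀ hS]; simp
  have hmul : ∀ S T x, ind S x * ind T x = ind (S ∩ T) x := fun S T x => by
    simp only [hind, Set.indicator, Set.mem_inter_iff]; split_ifs <;> simp_all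
  set X : Ω → ℝ := fun x => ∑ i ∈ s, (ind (U i) x - ind (V i) x) with hX
  have hXint : Integrable X μ :=
    integrable_finsetSum _ fun i _ => (hint _ (hU i)).sub (hint _ (hV i))
  have hXsq : ∀ x, X x ^ 2 = ∑ i ∈ s, ∑ j ∈ s, (ind (U i ∩ U j) x + ind (V i ∩ V j) x
      - ind (U i ∩ V j) x - ind (U j ∩ V i) x) := fun x => by
    rw [sq, hX, Finset.sum_mul_sum]
    refine Finset.sum_congr rfl fun i _ => Finset.sum_congr rfl fun j _ => ?_
    rw [← hmul, ← hmul, ← hmul, ← hmul]; ring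
  have hterm : ∀ i j, Integrable (fun x => ind (U i ∩ U j) x + ind (V i ∩ V j) x
      - ind (U i ∩ V j) x - ind (U j ∩ V i) x) μ := fun i j =>
    (((hint _ ((hU i).inter (hU j))).add (hint _ ((hV i).inter (hV j)))).sub
      (hint _ ((hU i).inter (hV j)))).sub (hint _ ((hU j).inter (hV i)))
  have hsqint : Integrable (fun x => X x ^ 2) μ := by
    simp only [hXsq]
    exact integrable_finsetSum _ fun i _ => integrable_finsetSum _ fun j _ => hterm i j
  have hsq : ∫ x, X x ^ 2 ∂μ ≤ 4 * s.card := by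
    have e : ∫ x, X x ^ 2 ∂μ = ∑ i ∈ s, ∑ j ∈ s, (μ.real (U i ∩ U j) + μ.real (V i ∩ V j)
        - μ.real (U i ∩ V j) - μ.real (U j ∩ V i)) := by
      simp only [hXsq]
      rw [integral_finsetSum _ fun i _ => integrable_finsetSum _ fun j _ => hterm i j]
      refine Finset.sum_congr rfl fun i _ => ?_
      rw [integral_finsetSum _ fun j _ => hterm i j]
      refine Finset.sum_congr rfl fun j _ => ?_
      have a1 := hint _ ((hU i).inter (hU j))
      have a2 := hint _ ((hV i).inter (hV j))
      have a3 := hint _ ((hU i).inter (hV j))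
      have a4 := hint _ ((hU j).inter (hV i))
      have e1 := integral_sub ((a1.add a2).sub a3) a4
      have e2 := integral_sub (a1.add a2) a3
      have e3 := integral_add a1 a2
      simp only [Pi.add_apply, Pi.sub_apply] at e1 e2 e3
      rw [e1, e2, e3, hval _ ((hU i).inter (hU j)), hval _ ((hV i).inter (hV j)),
        hval _ ((hU i).inter (hV j)), hval _ ((hU j).inter (hV i))]
    rw [e]
    simp only [Finset.sum_sub_distrib, Finset.sum_add_distrib]
    rw [Finset.sum_comm (f := fun i j => μ.real (U j ∩ V i))]
    linarith
  have hpt : ∀ x, |X x| ≤ η * X x ^ 2 + 1 / (4 * η) := fun x => by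
    have h1 : η * X x ^ 2 + 1 / (4 * η) - |X x| = η * (|X x| - 1 / (2 * η)) ^ 2 := by
      rw [← sq_abs (X x)]; field_simp; ring
    have h2 : 0 ≤ η * (|X x| - 1 / (2 * η)) ^ 2 := by positivity
    linarith
  have hsum : ∑ i ∈ s, (μ.real (U i ∩ W) - μ.real (V i ∩ W)) = ∫ x in W, X x ∂μ := by
    have hd : ∀ i, Integrable (fun x => ind (U i) x - ind (V i) x) (μ.restrict W) := fun i =>
      ((hint _ (hU i)).sub (hint _ (hV i))).integrableOn
    simp only [hX]
    rw [integral_finsetSum _ fun i _ => hd i]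
    refine Finset.sum_congr rfl fun i _ => ?_
    have hset : ∀ S, NullMeasurableSet S μ → ∫ x in W, ind S x ∂μ = μ.real (S ∩ W) :=
      fun S hS => by
        rw [← integral_indicator₀ hW, ← hval _ (hS.inter hW)]
        simp only [hind]
        rw [Set.indicator_indicator, Set.inter_comm]
    rw [integral_sub (hint _ (hU i)).integrableOn (hint _ (hV i)).integrableOn,
      hset _ (hU i), hset _ (hV i)]
  calc |∑ i ∈ s, (μ.real (U i ∩ W) - μ.real (V i ∩ W))|
      ≤ ∫ x in W, |X x| ∂μ := by rw [hsum]; exact abs_integral_le_integral_abs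
    _ ≤ ∫ x, |X x| ∂μ :=
        setIntegral_le_integral hXint.abs (Filter.Eventually.of_forall fun x => abs_nonneg _)
    _ ≤ ∫ x, (η * X x ^ 2 + 1 / (4 * η)) ∂μ :=
        integral_mono hXint.abs ((hsqint.const_mul η).add (integrable_const _)) hpt
    _ = η * ∫ x, X x ^ 2 ∂μ + 1 / (4 * η) := by
        rw [integral_add (hsqint.const_mul η) (integrable_const _), integral_const_mul]; simp
    _ ≤ 4 * η * s.card + 1 / (4 * η) := by nlinarith

end Equidistribution

section Rows

variable {F : Type} [MeasurableSpace F]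

lemma measurable_row (i : Fin 2) : Measurable fun M : Mat2 F => M i := measurable_pi_apply i

lemma measurableSet_rows {A B : Set (Fin 2 → F)} (hA : MeasurableSet A) (hB : MeasurableSet B) :
    MeasurableSet {M : Mat2 F | M 0 ∈ A ∧ M 1 ∈ B} :=
  (measurable_row 0 hA).inter (measurable_row 1 hB)

/-- Products of measurable sets of rows, as sets of matrices. -/
def rowRectangles (F : Type) [MeasurableSpace F] : Set (Set (Mat2 F)) :=
  {S | ∃ A B : Set (Fin 2 → F), MeasurableSet A ∧ MeasurableSet B ∧
    S = {M | M 0 ∈ A ∧ M 1 ∈ B}}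

lemma rowRectangles_eq : rowRectangles F = Set.pi Set.univ ''
    Set.pi Set.univ fun _ : Fin 2 => {s : Set (Fin 2 → F) | MeasurableSet s} := by
  ext S
  constructor
  · rintro ⟨A, B, hA, hB, rfl⟩
    refine ⟨![A, B], ?_, ?_⟩
    · intro i _; fin_cases i <;> assumption
    · ext M; simp [Set.mem_pi, Fin.forall_fin_two]; exact Iff.rfl
  · rintro ⟨t, ht, rfl⟩
    refine ⟨t 0, t 1, ht 0 trivial, ht 1 trivial, ?_⟩
    ext M; simp [Set.mem_pi, Fin.forall_fin_two]; exact Iff.rfl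

lemma isPiSystem_rowRectangles : IsPiSystem (rowRectangles F) := by
  rw [rowRectangles_eq]; exact isPiSystem_pi

lemma generateFrom_rowRectangles : (inferInstance : MeasurableSpace (Mat2 F)) =
    MeasurableSpace.generateFrom (rowRectangles F) := by
  rw [rowRectangles_eq]; exact generateFrom_pi.symm

end Rows

section RowOperations

variable {F : Type} [Field F]

/-- The linear combination `p · M₀ + r · M₁` of the rows of a matrix. -/
def rowComb (p r : F) (M : Mat2 F) : Fin 2 → F := p • M 0 + r • M 1

lemma mul_row_zero (p r t u : F) (M : Mat2 F) :
    (!![p, r; t, u] * M) 0 = rowComb p r M := by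
  ext j; simp [rowComb, Matrix.mul_apply, Fin.sum_univ_two]

lemma mul_row_one (p r t u : F) (M : Mat2 F) :
    (!![p, r; t, u] * M) 1 = rowComb t u M := by
  ext j; simp [rowComb, Matrix.mul_apply, Fin.sum_univ_two]

lemma mem_KSet_of {absF : F → ℝ} {p r t u : F} (hp : absF p ≤ 1) (hr : absF r ≤ 1) (ht : absF t ≤ 1)
    (hu : absF u ≤ 1) (hd : absF (p * u - r * t) = 1) : !![p, r; t, u] ∈ KSet absF := by
  refine ⟨fun i j => ?_, by rwa [Matrix.det_fin_two_of]⟩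
  fin_cases i <;> fin_cases j <;> simpa

end RowOperations

section Haar

variable {F : Type} [Field F] [MeasurableSpace F] {absF : F → ℝ} {μK : Measure (Mat2 F)}

namespace HaarOnK

lemma isProbabilityMeasure (hK : HaarOnK F absF μK) : IsProbabilityMeasure μK := by
  refine ⟨le_antisymm ?_ ?_⟩
  · rw [← Set.union_compl_self (KSet absF)]
    refine (measure_union_le _ _).trans ?_
    rw [hK.vol_K, hK.null_outside, add_zero]
  · rw [← hK.vol_K]; exact measure_mono (Set.subset_univ _)

lemma ae_mem (hK : HaarOnK F absF μK) : ∀ᵐ k ∂μK, k ∈ KSet absF := hK.null_outside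

lemma aemeasurable_of_map_eq (hK : HaarOnK F absF μK) {f : Mat2 F → Mat2 F}
    (hf : Measure.map f μK = μK) : AEMeasurable f μK := by
  by_contra h
  rw [Measure.map_of_not_aemeasurable h] at hf
  have := hK.vol_K
  rw [← hf] at this
  simp at this

lemma measure_preimage_of_map_eq (hK : HaarOnK F absF μK) {f : Mat2 F → Mat2 F}
    (hf : Measure.map f μK = μK) {S : Set (Mat2 F)} (hS : NullMeasurableSet S μK) :
    μK (f ⁻¹' S) = μK S := by
  rw [← Measure.map_apply₀ (hK.aemeasurable_of_map_eq hf) (by rwa [hf]), hf]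

lemma nullMeasurableSet_preimage_of_map_eq (hK : HaarOnK F absF μK) {f : Mat2 F → Mat2 F}
    (hf : Measure.map f μK = μK) {S : Set (Mat2 F)} (hS : NullMeasurableSet S μK) :
    NullMeasurableSet (f ⁻¹' S) μK := by
  obtain ⟨T, hT, hST⟩ := hS
  have hm := hK.aemeasurable_of_map_eq hf
  refine (hm.nullMeasurableSet_preimage hT).congr ?_
  have h := Measure.tendsto_ae_map hm
  rw [hf] at h
  exact (h.eventually hST).mono fun x hx => hx.symm

end HaarOnK

namespace HaarOnK

lemma measure_rowComb (hK : HaarOnK F absF μK) {p r t u : F}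
    (hg : !![p, r; t, u] ∈ KSet absF) {A B : Set (Fin 2 → F)} (hA : MeasurableSet A)
    (hB : MeasurableSet B) :
    μK {M | rowComb p r M ∈ A ∧ rowComb t u M ∈ B} = μK {M | M 0 ∈ A ∧ M 1 ∈ B} := by
  rw [← hK.measure_preimage_of_map_eq (hK.left_invariant _ hg)
    (measurableSet_rows hA hB).nullMeasurableSet]
  simp only [Set.preimage_ofPred_eq, mul_row_zero, mul_row_one]

lemma aemeasurable_rowComb (hK : HaarOnK F absF μK) {p r t u : F}
    (hg : !![p, r; t, u] ∈ KSet absF) : AEMeasurable (rowComb p r) μK := by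
  have := (measurable_row 0).comp_aemeasurable (hK.aemeasurable_of_map_eq (hK.left_invariant _ hg))
  refine this.congr (Filter.Eventually.of_forall fun M => ?_)
  exact mul_row_zero p r t u M

end HaarOnK

section PairCorrelations

variable {ι : Type*} {m : ι → ι → ℝ} {c : ℝ} (s : Finset ι)

lemma sum_sum_le_of_off_diagonal (hc : 0 ≤ c) (hm : ∀ i j, m i j ≤ 1)
    (hne : ∀ i j, i ≠ j → m i j = c) :
    ∑ i ∈ s, ∑ j ∈ s, m i j ≤ c * s.card ^ 2 + s.card := by
  classical
  calc ∑ i ∈ s, ∑ j ∈ s, m i j ≤ ∑ i ∈ s, ∑ j ∈ s, (c + if i = j then 1 else 0) := by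
        refine Finset.sum_le_sum fun i _ => Finset.sum_le_sum fun j _ => ?_
        split_ifs with h
        · linarith [hm i j]
        · rw [hne i j h, add_zero]
    _ = c * s.card ^ 2 + s.card := by
        simp [Finset.sum_add_distrib]; ring

lemma le_sum_sum_of_few_exceptions (hc : c ≤ 1) (hm : ∀ i j, 0 ≤ m i j) {bad : ι → ι → Prop}
    (hbad : ∀ i i' j, bad i j → bad i' j → i = i') (hgood : ∀ i j, ¬ bad i j → m i j = c) :
    c * s.card ^ 2 - s.card ≤ ∑ i ∈ s, ∑ j ∈ s, m i j := by
  classical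
  calc c * s.card ^ 2 - s.card = ∑ j ∈ s, ∑ i ∈ s, c - ∑ j ∈ s, (1 : ℝ) := by simp; ring
    _ ≤ ∑ j ∈ s, ∑ i ∈ s, c - ∑ j ∈ s, ∑ i ∈ s, (if bad i j then (1 : ℝ) else 0) := by
        refine sub_le_sub_left (Finset.sum_le_sum fun j _ => ?_) _
        rw [Finset.sum_boole]
        exact_mod_cast Finset.card_le_one.2 fun i hi i' hi' =>
          hbad i i' j (Finset.mem_filter.1 hi).2 (Finset.mem_filter.1 hi').2
    _ = ∑ j ∈ s, ∑ i ∈ s, (c - if bad i j then 1 else 0) := by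
        simp only [Finset.sum_sub_distrib]
    _ ≤ ∑ j ∈ s, ∑ i ∈ s, m i j := by
        refine Finset.sum_le_sum fun j _ => Finset.sum_le_sum fun i _ => ?_
        split_ifs with h
        · linarith [hm i j]
        · rw [hgood i j h, sub_zero]
    _ = ∑ i ∈ s, ∑ j ∈ s, m i j := Finset.sum_comm

end PairCorrelations

namespace HaarOnK

variable {ι : Type*} {l : ι → F}

lemma measureReal_rowComb (hK : HaarOnK F absF μK) {p r t u : F}
    (hg : !![p, r; t, u] ∈ KSet absF) {A B : Set (Fin 2 → F)} (hA : MeasurableSet A)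
    (hB : MeasurableSet B) :
    μK.real ({M | rowComb p r M ∈ A} ∩ {M | rowComb t u M ∈ B}) =
      μK.real {M | M 0 ∈ A ∧ M 1 ∈ B} :=
  congrArg ENNReal.toReal (hK.measure_rowComb hg hA hB)

lemma sublinearSums_rowComb (hK : HaarOnK F absF μK) (h : IsNonarchAbs absF)
    (hl1 : ∀ i, absF (l i) = 1) (hl : ∀ i j, i ≠ j → absF (l i - l j) = 1)
    {A : Set (Fin 2 → F)} (hA : MeasurableSet A) {W : Set (Mat2 F)}
    (hW : NullMeasurableSet W μK) :
    SublinearSums fun i => μK.real ({M | rowComb (l i) 1 M ∈ A} ∩ W) -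
      μK.real ({M | rowComb 1 (l i + 1) M ∈ A} ∩ W) := by
  have := hK.isProbabilityMeasure
  have h1 : absF (1 : F) ≤ 1 := h.map_one.le
  have h0 : absF (0 : F) ≤ 1 := by rw [h.map_zero]; exact zero_le_one
  have hl' : ∀ i, absF (l i + 1) ≤ 1 := fun i => h.add_le (hl1 i).le h1
  have hU : ∀ i, NullMeasurableSet {M | rowComb (l i) 1 M ∈ A} μK := fun i =>
    (hK.aemeasurable_rowComb (mem_KSet_of (hl1 i).le h1 h0 h1
      (by rw [mul_one, mul_zero, sub_zero, hl1]))).nullMeasurableSet_preimage hA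
  have hV : ∀ i, NullMeasurableSet {M | rowComb 1 (l i + 1) M ∈ A} μK := fun i =>
    (hK.aemeasurable_rowComb (mem_KSet_of h1 (hl' i) h0 h1
      (by rw [mul_one, mul_zero, sub_zero, h.map_one]))).nullMeasurableSet_preimage hA
  intro ε hε
  refine ⟨1 / (4 * (ε / 4)), fun s => ?_⟩
  have key := abs_sum_measureReal_inter_sub_le s hU hV hW
    (c := μK.real {M | M 0 ∈ A ∧ M 1 ∈ A}) ?_ ?_ ?_ (η := ε / 4) (by positivity)
  · convert key using 3; ring
  · refine sum_sum_le_of_off_diagonal s measureReal_nonneg (fun _ _ => measureReal_le_one)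
      fun i j hij => hK.measureReal_rowComb (mem_KSet_of (hl1 i).le h1 (hl1 j).le h1 ?_) hA hA
    rw [mul_one, one_mul, hl i j hij]
  · refine sum_sum_le_of_off_diagonal s measureReal_nonneg (fun _ _ => measureReal_le_one)
      fun i j hij => hK.measureReal_rowComb (mem_KSet_of h1 (hl' i) h1 (hl' j) ?_) hA hA
    rw [mul_one, one_mul, add_sub_add_right_eq_sub, hl j i hij.symm]
  · refine le_sum_sum_of_few_exceptions s measureReal_le_one (fun _ _ => measureReal_nonneg)
      (bad := fun i j => absF (l i * (l j + 1) - 1) < 1) ?_ ?_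
    · intro i i' j hi hi'
      by_contra hne
      have e : absF (l j + 1) < 1 := by
        have := h.sub_lt hi hi'
        rw [sub_sub_sub_cancel_right, ← sub_mul, h.mul, hl i i' hne, one_mul] at this
        exact this
      have e2 := h.mul_lt_one_right (hl1 i).le e
      have := h.sub_lt e2 hi
      rw [sub_sub_cancel, h.map_one] at this
      exact lt_irrefl _ this
    · intro i j hij
      refine hK.measureReal_rowComb (mem_KSet_of (hl1 i).le h1 h1 (hl' j) ?_) hA hA
      rw [one_mul]
      exact le_antisymm (h.sub_le (h.mul_le_one (hl1 i).le (hl' j)) h1) (not_lt.1 hij)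

lemma map_restrict_apply (hK : HaarOnK F absF μK) {g : Mat2 F} (hg : g ∈ KSet absF)
    {V : Set (Mat2 F)} (hV : MeasurableSet V) {E : Set (Mat2 F)} (hE : MeasurableSet E) :
    (μK.restrict V).map (fun k => g * k) E = μK ((fun k => g * k) ⁻¹' E ∩ V) := by
  rw [Measure.map_apply_of_aemeasurable
    (hK.aemeasurable_of_map_eq (hK.left_invariant _ hg)).restrict hE, Measure.restrict_apply' hV]

lemma map_restrict_le (hK : HaarOnK F absF μK) {g : Mat2 F} (hg : g ∈ KSet absF)
    {V : Set (Mat2 F)} (hV : MeasurableSet V) :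
    (μK.restrict V).map (fun k => g * k) ≤ μK := by
  refine Measure.le_iff.2 fun E hE => ?_
  rw [hK.map_restrict_apply hg hV hE]
  refine (measure_mono Set.inter_subset_left).trans_eq ?_
  exact hK.measure_preimage_of_map_eq (hK.left_invariant _ hg) hE.nullMeasurableSet

/-- Averaged over units `l i`, proportional rows are distributed like independent ones. -/
lemma sublinearSums_proportional (hK : HaarOnK F absF μK) (h : IsNonarchAbs absF)
    (hl1 : ∀ i, absF (l i) = 1) (hl : ∀ i j, i ≠ j → absF (l i - l j) = 1)
    {A B : Set (Fin 2 → F)} (hA : MeasurableSet A) (hB : MeasurableSet B) :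
    SublinearSums fun i => μK.real {M | l i • M 0 ∈ A ∧ M 0 ∈ B} -
      μK.real {M | M 0 ∈ A ∧ M 1 ∈ B} := by
  have := hK.isProbabilityMeasure
  have h1 : absF (1 : F) ≤ 1 := h.map_one.le
  have h0 : absF (0 : F) ≤ 1 := by rw [h.map_zero]; exact zero_le_one
  have hl' : ∀ i, absF (l i + 1) ≤ 1 := fun i => h.add_le (hl1 i).le h1
  have hg₁ : ∀ i, !![l i, 1; 0, 1] ∈ KSet absF := fun i => mem_KSet_of (hl1 i).le h1 h0 h1
    (by rw [mul_one, mul_zero, sub_zero, hl1])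
  have hg₂ : ∀ i, !![1, l i + 1; 0, 1] ∈ KSet absF := fun i => mem_KSet_of h1 (hl' i) h0 h1
    (by rw [mul_one, mul_zero, sub_zero, h.map_one])
  have hV : MeasurableSet {M : Mat2 F | M 0 ∈ B} := measurable_row 0 hB
  have hrow : ∀ M : Mat2 F, rowComb 0 1 M = M 1 := fun M => by simp [rowComb]
  obtain ⟨E, hE, hEE⟩ : NullMeasurableSet {M | rowComb 1 (-1) M ∈ A} μK :=
    (hK.aemeasurable_rowComb (mem_KSet_of (u := 1) h1 (by rw [h.map_neg]; exact h1) h0 h1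
      (by rw [mul_one, mul_zero, sub_zero, h.map_one]))).nullMeasurableSet_preimage hA
  have hpre : ∀ g ∈ KSet absF, ((μK.restrict {M : Mat2 F | M 0 ∈ B}).map fun k => g * k).real E =
      μK.real {M | rowComb 1 (-1) (g * M) ∈ A ∧ M 0 ∈ B} := by
    intro g hg
    rw [measureReal_def, hK.map_restrict_apply hg hV hE]
    refine congrArg ENNReal.toReal (measure_congr ?_)
    have ht := Measure.tendsto_ae_map (hK.aemeasurable_of_map_eq (hK.left_invariant _ hg))
    rw [hK.left_invariant _ hg] at ht
    have e : (fun k => g * k) ⁻¹' E =ᵐ[μK] (fun k => g * k) ⁻¹' {M | rowComb 1 (-1) M ∈ A} :=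
      (ht.eventually hEE).mono fun x hx => hx.symm
    exact e.inter (ae_eq_refl _)
  convert sublinearSums_measureReal_sub (μ := μK) (fun i => hK.map_restrict_le (hg₁ i) hV)
    (fun i => hK.map_restrict_le (hg₂ i) hV) ?_ generateFrom_rowRectangles
    isPiSystem_rowRectangles ?_ hE using 3 with i i
  · rw [hpre _ (hg₁ i)]
    congr 1
    ext M
    have : rowComb 1 (-1) (!![l i, 1; 0, 1] * M) = l i • M 0 := by
      rw [rowComb, mul_row_zero, mul_row_one]; ext j; simp [rowComb]
    simp only [Set.mem_ofPred_eq, this]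
  · rw [hpre _ (hg₂ i)]
    have e : ∀ M, rowComb 1 (-1) (!![1, l i + 1; 0, 1] * M) = rowComb 1 (l i) M := fun M => by
      rw [rowComb, mul_row_zero, mul_row_one]; ext j; simp [rowComb]; ring
    have e' : ∀ M : Mat2 F, M 0 = rowComb 1 0 M := fun M => by simp [rowComb]
    have hg₃ : !![1, l i; 1, 0] ∈ KSet absF := mem_KSet_of h1 (hl1 i).le h1 h0
      (by rw [mul_zero, mul_one, zero_sub, h.map_neg, hl1])
    rw [← hK.measureReal_rowComb hg₃ hA hB]
    congr 1
    ext M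
    simp only [Set.mem_ofPred_eq, Set.mem_inter_iff, e, ← e']
  · intro i
    rw [hK.map_restrict_apply (hg₁ i) hV MeasurableSet.univ,
      hK.map_restrict_apply (hg₂ i) hV MeasurableSet.univ, Set.preimage_univ, Set.preimage_univ]
  · rintro _ ⟨A', B', hA', hB', rfl⟩
    have hm := measurableSet_rows hA' hB'
    convert hK.sublinearSums_rowComb h hl1 hl hA'
      ((measurable_row 1 hB').inter (measurable_row 0 hB)).nullMeasurableSet using 3 with i i
    · rw [measureReal_def, hK.map_restrict_apply (hg₁ i) hV hm]
      refine congrArg (fun S => (μK S).toReal) ?_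
      ext M
      simp only [Set.mem_inter_iff, Set.mem_preimage, Set.mem_ofPred_eq, mul_row_zero, mul_row_one,
        hrow, and_assoc]
    · rw [measureReal_def, hK.map_restrict_apply (hg₂ i) hV hm]
      refine congrArg (fun S => (μK S).toReal) ?_
      ext M
      simp only [Set.mem_inter_iff, Set.mem_preimage, Set.mem_ofPred_eq, mul_row_zero, mul_row_one,
        hrow, and_assoc]

/-- There are only countably many units with pairwise distinct residue classes. -/
lemma countable_of_pairwise (hK : HaarOnK F absF μK) (h : IsNonarchAbs absF)
    (hl1 : ∀ i, absF (l i) = 1) (hl : ∀ i j, i ≠ j → absF (l i - l j) = 1) : Countable ι := by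
  have := hK.isProbabilityMeasure
  have h1 : absF (1 : F) ≤ 1 := h.map_one.le
  have h0 : absF (0 : F) ≤ 1 := by rw [h.map_zero]; exact zero_le_one
  set D : ι → Mat2 F → Mat2 F := fun i M => Matrix.of ![l i • M 0, M 0] with hD
  have hDm : ∀ i, AEMeasurable (D i) μK := fun i => by
    refine aemeasurable_pi_lambda _ fun j => ?_
    fin_cases j
    · refine (hK.aemeasurable_rowComb (p := l i) (r := 0) (t := 0) (u := 1)
        (mem_KSet_of (hl1 i).le h0 h0 h1 (by rw [mul_one, mul_zero, sub_zero, hl1]))).congr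
        (Filter.Eventually.of_forall fun M => ?_)
      simp [rowComb, hD]; rfl
    · exact (measurable_row 0).aemeasurable
  have hDp : ∀ i, IsProbabilityMeasure (μK.map (D i)) := fun i =>
    Measure.isProbabilityMeasure_map (hDm i)
  have key : ∀ S, MeasurableSet S → {i | (μK.map (D i)) S ≠ μK S}.Countable := by
    refine MeasurableSpace.induction_on_inter generateFrom_rowRectangles
      isPiSystem_rowRectangles (by simp) ?_ ?_ ?_
    · rintro _ ⟨A, B, hA, hB, rfl⟩
      refine (hK.sublinearSums_proportional h hl1 hl hA hB).countable_ne_zero.mono fun i hi => ?_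
      intro hz
      refine hi ?_
      rw [Measure.map_apply_of_aemeasurable (hDm i) (measurableSet_rows hA hB)]
      exact (measureReal_eq_measureReal_iff).1 (sub_eq_zero.1 hz)
    · intro t ht ih
      refine ih.mono fun i hi => ?_
      contrapose! hi
      simp only [Set.mem_ofPred_eq, not_not] at hi ⊢
      rw [prob_compl_eq_one_sub ht, prob_compl_eq_one_sub ht, hi]
    · intro f hd hm ih
      refine (Set.countable_iUnion ih).mono fun i hi => ?_
      contrapose! hi
      simp only [Set.mem_iUnion, Set.mem_ofPred_eq, not_exists, not_not] at hi ⊢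
      rw [measure_iUnion hd hm, measure_iUnion hd hm]
      exact tsum_congr hi
  set T := (toMeasurable μK (KSet absF)ᶜ)ᶜ with hT
  have hTm : MeasurableSet T := (measurableSet_toMeasurable _ _).compl
  have hTK : T ⊆ KSet absF := Set.compl_subset_comm.1 (subset_toMeasurable _ _)
  have hT1 : μK T = 1 := by
    rw [hT, prob_compl_eq_one_sub (measurableSet_toMeasurable _ _), measure_toMeasurable,
      hK.null_outside, tsub_zero]
  refine Set.countable_univ_iff.1 ((key T hTm).mono fun i _ => ?_)
  have hem : D i ⁻¹' T = ∅ := by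
    refine Set.eq_empty_of_forall_notMem fun M hM => ?_
    have hdet := (hTK hM).2
    have : (D i M).det = 0 := by rw [Matrix.det_fin_two]; simp [hD]; ring
    rw [this, h.map_zero] at hdet
    exact zero_ne_one hdet
  rw [Set.mem_ofPred_eq, Measure.map_apply_of_aemeasurable (hDm i) hTm, hem, hT1, measure_empty]
  exact zero_ne_one

lemma countable_residue (hK : HaarOnK F absF μK) (h : IsNonarchAbs absF) :
    Countable h.Residue := by
  have hz : absF 0 ≤ 1 := by simp [h.map_zero]
  have : Countable {c : h.Residue // c ≠ h.res 0 hz} :=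
    hK.countable_of_pairwise h (l := fun c => h.rep c.1) (fun c => h.rep_eq_one c.2)
      fun c d hcd => h.rep_sub_eq_one fun e => hcd (Subtype.ext e)
  have h1 : {c : h.Residue | c ≠ h.res 0 hz}.Countable := this
  have h2 : ({h.res 0 hz}ᶜᶜ : Set h.Residue).Countable := by simp
  refine Set.countable_univ_iff.1 ((h1.union h2).mono fun c _ => ?_)
  by_cases hc : c = h.res 0 hz
  · exact Or.inr (by simpa using hc)
  · exact Or.inl hc

end HaarOnK

lemma mul_mem_KSet {F : Type} [Field F] {absF : F → ℝ} (h : IsNonarchAbs absF) {k g : Mat2 F}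
    (hk : k ∈ KSet absF) (hg : g ∈ KSet absF) : k * g ∈ KSet absF := by
  refine ⟨fun i j => ?_, by rw [Matrix.det_mul, h.mul, hk.2, hg.2, one_mul]⟩
  rw [Matrix.mul_apply, Fin.sum_univ_two]
  exact h.add_le (h.mul_le_one (hk.1 _ _) (hg.1 _ _)) (h.mul_le_one (hk.1 _ _) (hg.1 _ _))

namespace HaarOnK

lemma finite_residue (hK : HaarOnK F absF μK) (h : IsNonarchAbs absF)
    (hℓ : NullMeasurableSet {k | k ∈ KSet absF ∧ absF (k 0 1) < 1} μK) :
    Finite h.Residue := by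
  have := hK.isProbabilityMeasure
  have hc := hK.countable_residue h
  have h1 : absF (1 : F) ≤ 1 := h.map_one.le
  have h0 : absF (0 : F) ≤ 1 := by rw [h.map_zero]; exact zero_le_one
  by_contra hfin
  rw [not_finite_iff_infinite] at hfin
  set ℓ := {k | k ∈ KSet absF ∧ absF (k 0 1) < 1} with hℓ_def
  have hg : ∀ c, !![0, 1; 1, -h.rep c] ∈ KSet absF := fun c => mem_KSet_of h0 h1 h1
    (by rw [h.map_neg]; exact h.rep_le c)
    (by rw [zero_mul, one_mul, zero_sub, h.map_neg, h.map_one])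
  set S : h.Residue → Set (Mat2 F) := fun c => (fun k => k * !![0, 1; 1, -h.rep c]) ⁻¹' ℓ with hS
  have hmap := fun c => hK.right_invariant _ (hg c)
  have e00 : ∀ (k : Mat2 F) c, (k * !![0, 1; 1, -h.rep c]) 0 0 = k 0 1 := fun k c => by
    simp [Matrix.mul_apply, Fin.sum_univ_two]
  have e01 : ∀ (k : Mat2 F) c, (k * !![0, 1; 1, -h.rep c]) 0 1 = k 0 0 - h.rep c * k 0 1 :=
    fun k c => by simp [Matrix.mul_apply, Fin.sum_univ_two]; ring
  have hmem : ∀ k c, k ∈ S c ↔ k * !![0, 1; 1, -h.rep c] ∈ KSet absF ∧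
      absF (k 0 0 - h.rep c * k 0 1) < 1 := fun k c => by rw [← e01]; rfl
  have hdisj : Pairwise (Function.onFun Disjoint S) := by
    intro c d hcd
    refine Set.disjoint_left.2 fun k hkc hkd => ?_
    obtain ⟨hkK, hkc⟩ := (hmem k c).1 hkc
    have hkd := ((hmem k d).1 hkd).2
    have h01 : absF (k 0 1) < 1 := by
      have h2 := h.sub_lt hkd hkc
      have e : k 0 0 - h.rep d * k 0 1 - (k 0 0 - h.rep c * k 0 1)
        = (h.rep c - h.rep d) * k 0 1 := by ring
      rwa [e, h.mul, h.rep_sub_eq_one hcd, one_mul] at h2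
    have hdet := hkK.2
    rw [Matrix.det_fin_two] at hdet
    refine absurd hdet (ne_of_lt (h.sub_lt (h.mul_lt_one_left ?_ (hkK.1 _ _))
      (h.mul_lt_one_left ?_ (hkK.1 _ _))))
    · rwa [e00]
    · rwa [e01]
  have hSm : ∀ c, μK (S c) = μK ℓ := fun c => hK.measure_preimage_of_map_eq (hmap c) hℓ
  have hun : μK (⋃ c, S c) = ∑' _ : h.Residue, μK ℓ := by
    rw [measure_iUnion₀ (fun c d hcd => (hdisj hcd).aedisjoint)
      fun c => hK.nullMeasurableSet_preimage_of_map_eq (hmap c) hℓ]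
    exact tsum_congr hSm
  have hℓ0 : μK ℓ = 0 := by
    by_contra hne
    rw [ENNReal.tsum_const_eq_top_of_ne_zero hne] at hun
    exact measure_ne_top μK _ hun
  have hcover : KSet absF ⊆ ℓ ∪ ⋃ c, S c := by
    intro k hk
    by_cases hlt : absF (k 0 1) < 1
    · exact Or.inl ⟨hk, hlt⟩
    have h01 : absF (k 0 1) = 1 := le_antisymm (hk.1 0 1) (not_lt.1 hlt)
    have hne : k 0 1 ≠ 0 := fun e => by rw [e, h.map_zero] at h01; exact zero_ne_one h01
    have hq : absF (k 0 0 / k 0 1) ≤ 1 := by rw [h.map_div, h01, div_one]; exact hk.1 0 0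
    refine Or.inr (Set.mem_iUnion.2 ⟨h.res _ hq, (hmem k _).2 ⟨mul_mem_KSet h hk (hg _), ?_⟩⟩)
    have h2 := h.sub_rep_lt hq
    have e : k 0 0 - h.rep (h.res _ hq) * k 0 1
        = (k 0 0 / k 0 1 - h.rep (h.res _ hq)) * k 0 1 := by field_simp
    rw [e, h.mul, h01, mul_one]
    exact h2
  have hle := (measure_mono hcover).trans (measure_union_le (μ := μK) _ _)
  rw [hun, hℓ0, tsum_zero, add_zero, hK.vol_K] at hle
  exact absurd hle (not_le.2 zero_lt_one)

lemma finite_residue_of_sub (hK : HaarOnK F absF μK) (h : IsNonarchAbs absF)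
    (hℓ : NullMeasurableSet {k | k ∈ KSet absF ∧ absF (k 0 0 - k 0 1) < 1} μK) :
    Finite h.Residue := by
  have h1 : absF (1 : F) ≤ 1 := h.map_one.le
  have h0 : absF (0 : F) ≤ 1 := by rw [h.map_zero]; exact zero_le_one
  have hg : !![1, 1; 1, 0] ∈ KSet absF := mem_KSet_of h1 h1 h1 h0
    (by rw [mul_zero, one_mul, zero_sub, h.map_neg, h.map_one])
  refine hK.finite_residue h
    ((hK.nullMeasurableSet_preimage_of_map_eq (hK.right_invariant _ hg) hℓ).congr ?_)
  filter_upwards [hK.ae_mem] with k hk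
  refine propext ?_
  have e : (k * (!![1, 1; 1, 0] : Mat2 F) : Mat2 F) 0 0 -
      (k * (!![1, 1; 1, 0] : Mat2 F) : Mat2 F) 0 1 = k 0 1 := by
    simp [Matrix.mul_apply, Fin.sum_univ_two]
  change (k * (!![1, 1; 1, 0] : Mat2 F) ∈ KSet absF ∧
    absF ((k * (!![1, 1; 1, 0] : Mat2 F) : Mat2 F) 0 0 -
      (k * (!![1, 1; 1, 0] : Mat2 F) : Mat2 F) 0 1) < 1) ↔ (k ∈ KSet absF ∧ absF (k 0 1) < 1)
  rw [e]
  exact and_congr_left fun _ => iff_of_true (mul_mem_KSet h hk hg) hk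

end HaarOnK

end Haar

section HermitianAction

variable {F : Type} [Field F] (conj : F →+* F)

lemma ctrans_mul (k g : Mat2 F) : ctrans conj (k * g) = ctrans conj g * ctrans conj k := by
  ext i j
  simp [ctrans, Matrix.mul_apply, Fin.sum_univ_two, mul_comm]

lemma det_mul_ctrans (k x : Mat2 F) :
    (k * x * ctrans conj k).det = k.det * conj k.det * x.det := by
  have : (ctrans conj k).det = conj k.det := by
    simp [ctrans, Matrix.det_fin_two, mul_comm]
  rw [Matrix.det_mul, Matrix.det_mul, this]; ring

lemma diag_action_apply (k : Mat2 F) (X Y : F) :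
    (k * !![X, 0; 0, Y] * ctrans conj k) 0 0 =
      X * (k 0 0 * conj (k 0 0)) + Y * (k 0 1 * conj (k 0 1)) := by
  simp [ctrans, Matrix.mul_apply, Fin.sum_univ_two]; ring

lemma similitude_action {b u c X Y : F} (h00 : X + Y * (b * conj b) = c * X)
    (h01 : X * conj u + Y * b = 0) (h10 : X * u + Y * conj b = 0)
    (h11 : X * (u * conj u) + Y = c * Y) :
    !![1, b; u, 1] * !![X, 0; 0, Y] * ctrans conj !![1, b; u, 1] = c • !![X, 0; 0, Y] := by
  ext i j
  fin_cases i <;> fin_cases j <;>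
    simp [ctrans, Matrix.mul_apply, Fin.sum_univ_two]
  · linear_combination h00
  · linear_combination h01
  · linear_combination h10
  · linear_combination h11

end HermitianAction

section Vanishing

variable {F : Type} [Field F] [MeasurableSpace F] {conj : F →+* F} {q : ℕ} {absF : F → ℝ}
  {vF : F → ℤ} {ϖ : F} {s : ℕ} {μF : Measure F}

/-- The integrand of the spherical function. -/
def sphericalIntegrand {F : Type} [Field F] (conj : F →+* F) (absF : F → ℝ) (χ₁ χ₂ : F → ℂ)
    (x : Mat2 F) (s₁ s₂ : ℂ) (k : Mat2 F) : ℂ :=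
  χ₁ ((k * x * ctrans conj k) 0 0) * ((absF ((k * x * ctrans conj k) 0 0) : ℂ)) ^ s₁
    * χ₂ ((k * x * ctrans conj k).det) * ((absF ((k * x * ctrans conj k).det) : ℂ)) ^ s₂

lemma Lsph_eq_integral {μK : Measure (Mat2 F)} (hK : HaarOnK F absF μK) (χ₁ χ₂ : F → ℂ)
    (x : Mat2 F) (s₁ s₂ : ℂ) : Lsph conj absF μK χ₁ χ₂ x s₁ s₂ =
      ∫ k, sphericalIntegrand conj absF χ₁ χ₂ x s₁ s₂ k ∂μK := by
  rw [Lsph, Measure.restrict_eq_self_of_ae_mem hK.ae_mem]; rfl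

namespace WildlyRamified

variable {ρ : F} {χ : F → ℂ}

lemma abs_form_lt_one_iff (hW : WildlyRamified F conj q absF vF ϖ s μF) {ε : F}
    (hε : absF ε = 1) {m : ℕ} (hm : m ≠ 0) {x y : F} (hx : absF x ≤ 1) :
    absF ((ϖ * conj ϖ) ^ m * (x * conj x) + ε * (y * conj y)) < 1 ↔ absF y < 1 := by
  have hN := hW.nonarch
  have h1 : absF ((ϖ * conj ϖ) ^ m * (x * conj x)) < 1 :=
    hN.mul_lt_one_left (hW.abs_pi_pow_lt hm) (hN.mul_le_one hx (by rwa [hW.conj_abs]))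
  have h2 : absF (ε * (y * conj y)) < 1 ↔ absF y < 1 := by
    rw [hW.abs_mul, hε, one_mul, hW.abs_norm]
    exact pow_lt_one_iff_of_nonneg (hW.abs_nonneg _) two_ne_zero
  rw [← h2]
  constructor
  · intro h; have := hN.sub_lt h h1; rwa [add_sub_cancel_left] at this
  · intro h; exact hN.add_lt h1 h

lemma abs_form_lt_one_iff_sub (hW : WildlyRamified F conj q absF vF ϖ s μF)
    (hρ : ρ ∈ UE conj absF)
    (hΔ : ¬ ∃ w : F, w ≠ 0 ∧ 1 + ρ * (ϖ * conj ϖ) ^ s = Nm conj w)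
    (hχ : NontrivialNormCharacter conj χ) {ε : F} (hε : absF (ε - 1) < 1) {x y : F}
    (hx : absF x ≤ 1) (hy : absF y ≤ 1) :
    absF (x * conj x + ε * (y * conj y)) < 1 ↔ absF (x - y) < 1 := by
  have hN := hW.nonarch
  have hy2 : absF (y * conj y) ≤ 1 := hN.mul_le_one hy (by rwa [hW.conj_abs])
  set E := (x * conj x - y * conj y - (x - y) ^ 2) + (2 * (y * conj y) + (ε - 1) * (y * conj y))
    with hE
  have hE1 : absF E < 1 := hN.add_lt (hW.abs_norm_sub_norm_sub_sq_lt hρ hΔ hχ hx hy)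
    (hN.add_lt (hN.mul_lt_one_left hW.abs_two_lt_one hy2) (hN.mul_lt_one_left hε hy2))
  have e : x * conj x + ε * (y * conj y) = E + (x - y) ^ 2 := by rw [hE]; ring
  have h2 : absF ((x - y) ^ 2) < 1 ↔ absF (x - y) < 1 := by
    rw [hN.map_pow]; exact pow_lt_one_iff_of_nonneg (hW.abs_nonneg _) two_ne_zero
  rw [e, ← h2]
  constructor
  · intro h; have := hN.sub_lt h hE1; rwa [add_sub_cancel_left] at this
  · intro h; exact hN.add_lt hE1 h

lemma norm_sphericalIntegrand (hW : WildlyRamified F conj q absF vF ϖ s μF)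
    {χ₁ χ₂ : F → ℂ} (hχ₁ : NontrivialNormCharacter conj χ₁) (hχ₂ : NormCharacter conj χ₂)
    {X Y : F} (hX : conj X = X) (hY : conj Y = Y) (hXY : X * Y ≠ 0) {s₁ s₂ : ℂ}
    (hs₁ : 0 < s₁.re) (hs₂ : 0 < s₂.re) {k : Mat2 F} (hk : k ∈ KSet absF) :
    ‖sphericalIntegrand conj absF χ₁ χ₂ !![X, 0; 0, Y] s₁ s₂ k‖ =
      absF (X * (k 0 0 * conj (k 0 0)) + Y * (k 0 1 * conj (k 0 1))) ^ s₁.re *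
        absF (X * Y) ^ s₂.re := by
  have hval : ∀ z : ℂ, z = 1 ∨ z = -1 → ‖z‖ = 1 := by
    rintro z (rfl | rfl) <;> simp
  have hd : (!![X, 0; 0, Y] : Mat2 F).det = X * Y := by rw [Matrix.det_fin_two_of]; ring
  have hk0 := hW.ne_zero_of_abs_eq_one hk.2
  have hck0 : conj k.det ≠ 0 := (map_ne_zero conj).2 hk0
  rw [sphericalIntegrand, diag_action_apply, det_mul_ctrans, hd]
  set y := X * (k 0 0 * conj (k 0 0)) + Y * (k 0 1 * conj (k 0 1)) with hy
  have hyc : conj y = y := by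
    rw [hy, map_add, map_mul, map_mul conj Y, hX, hY, hW.conj_norm, hW.conj_norm]
  have hdabs : absF (k.det * conj k.det * (X * Y)) = absF (X * Y) := by
    rw [hW.abs_mul, hW.abs_norm, hk.2, one_pow, one_mul]
  rw [norm_mul, norm_mul, norm_mul, hdabs,
    Complex.norm_cpow_eq_rpow_re_of_nonneg (hW.abs_nonneg _) hs₁.ne',
    Complex.norm_cpow_eq_rpow_re_of_nonneg (hW.abs_nonneg _) hs₂.ne',
    hval (χ₂ _) (hχ₂.values _ (by rw [map_mul, map_mul conj X, hX, hY, hW.conj_norm])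
      (mul_ne_zero (mul_ne_zero hk0 hck0) hXY)), mul_one]
  by_cases h0 : y = 0
  · rw [h0, hW.nonarch.map_zero, Real.zero_rpow hs₁.ne']; simp
  · rw [hval (χ₁ y) (hχ₁.values y hyc h0), one_mul]

lemma sphericalIntegrand_mul_similitude (hW : WildlyRamified F conj q absF vF ϖ s μF)
    {χ₁ χ₂ : F → ℂ} (hχ₁ : NontrivialNormCharacter conj χ₁) (hχ₂ : NormCharacter conj χ₂)
    {X Y c : F} (hX : conj X = X) (hY : conj Y = Y) (hc : conj c = c) (hc1 : absF c = 1)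
    (hcχ : χ₁ c = -1) {g : Mat2 F}
    (hg : g * !![X, 0; 0, Y] * ctrans conj g = c • !![X, 0; 0, Y]) (s₁ s₂ : ℂ) (k : Mat2 F) :
    sphericalIntegrand conj absF χ₁ χ₂ !![X, 0; 0, Y] s₁ s₂ (k * g) =
      -sphericalIntegrand conj absF χ₁ χ₂ !![X, 0; 0, Y] s₁ s₂ k := by
  have e : k * g * !![X, 0; 0, Y] * ctrans conj (k * g) =
      c • (k * !![X, 0; 0, Y] * ctrans conj k) := by
    have : k * g * !![X, 0; 0, Y] * ctrans conj (k * g) =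
        k * (g * !![X, 0; 0, Y] * ctrans conj g) * ctrans conj k := by
      rw [ctrans_mul]; simp only [Matrix.mul_assoc]
    rw [this, hg, Matrix.mul_smul, Matrix.smul_mul]
  have hd : (!![X, 0; 0, Y] : Mat2 F).det = X * Y := by rw [Matrix.det_fin_two_of]; ring
  rw [sphericalIntegrand, sphericalIntegrand, e, Matrix.det_smul, Matrix.smul_apply, smul_eq_mul,
    diag_action_apply, det_mul_ctrans, hd, Fintype.card_fin]
  have hc0 := hW.ne_zero_of_abs_eq_one hc1
  rw [hχ₁.map_mul c _ hc (by rw [map_add, map_mul, map_mul conj Y, hX, hY, hW.conj_norm,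
      hW.conj_norm]), hcχ, hW.abs_mul c, hc1, one_mul,
    hχ₂.map_mul (c ^ 2) _ (by rw [map_pow, hc]) (by rw [map_mul, map_mul conj X, hX, hY,
      hW.conj_norm]), hW.abs_mul (c ^ 2), hW.nonarch.map_pow, hc1, one_pow, one_mul]
  have h2 : χ₂ (c ^ 2) = 1 := by
    have := hχ₂.norm_trivial c hc0
    rwa [hc, ← sq] at this
  rw [h2]; ring

end WildlyRamified

lemma HaarOnK.integral_eq_zero_of_mul_eq_neg {μK : Measure (Mat2 F)} (hK : HaarOnK F absF μK)
    {f : Mat2 F → ℂ} (hf : AEStronglyMeasurable f μK) {g : Mat2 F} (hg : g ∈ KSet absF)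
    (hfg : ∀ k, f (k * g) = -f k) : ∫ k, f k ∂μK = 0 := by
  have hm := hK.right_invariant g hg
  have h : ∫ k, f k ∂μK = -∫ k, f k ∂μK := by
    calc ∫ k, f k ∂μK = ∫ k, f k ∂(μK.map fun k => k * g) := by rw [hm]
      _ = ∫ k, f (k * g) ∂μK :=
          integral_map (hK.aemeasurable_of_map_eq hm) (by rwa [hm])
      _ = -∫ k, f k ∂μK := by simp only [hfg, integral_neg]
  exact self_eq_neg.1 h

end Vanishing

/-- vanishing of `L(x, χ*, χ₂, z)` on the diagonal representatives
`x = diag(π^{λ₁}ε₁, π^{λ₂}ε₂)` with `λ₁ ≥ λ₂`, `ε₁, ε₂ ∈ {1, Δ}` and `λ₁ − λ₂ ≤ s`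
(so `ε₁ = 1`), for all `z = (z₁, z₂)` in the domain of absolute convergence
(`Re(s₁) > 0` and `Re(s₂) > 0`, where `s₁ = z₂ − z₁ − 1/2`, `s₂ = −z₂ + 1/4`).
Here `π = N(ϖ)` and `Δ = 1 + ρπ^s ∉ N(F*)`. -/
theorem L_vanishes_on_diagonal_small_gap
    {F : Type} [Field F] [MeasurableSpace F]
    (conj : F →+* F) (q : ℕ) (absF : F → ℝ) (vF : F → ℤ) (ϖ : F) (s : ℕ)
    (μF : Measure F)
    (hW : WildlyRamified F conj q absF vF ϖ s μF)
    (μK : Measure (Mat2 F)) (hK : HaarOnK F absF μK)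
    (ρ : F) (hρ : ρ ∈ UE conj absF)
    (hΔ : ¬ ∃ w : F, w ≠ 0 ∧ 1 + ρ * (ϖ * conj ϖ) ^ s = Nm conj w)
    (χstar χ₂ : F → ℂ)
    (hχs : NontrivialNormCharacter conj χstar) (hχ₂ : NormCharacter conj χ₂)
    (lam₁ lam₂ : ℤ) (hlam : lam₂ ≤ lam₁) (hgap : lam₁ - lam₂ ≤ (s : ℤ))
    (ε₁ ε₂ : F) (hε₁ : ε₁ = 1)
    (hε₂ : ε₂ = 1 ∨ ε₂ = 1 + ρ * (ϖ * conj ϖ) ^ s)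
    (z₁ z₂ : ℂ) (hz₁ : 0 < (z₂ - z₁ - 1/2).re) (hz₂ : 0 < (-z₂ + 1/4).re) :
    Lsph conj absF μK χstar χ₂
        !![(ϖ * conj ϖ) ^ lam₁ * ε₁, 0; 0, (ϖ * conj ϖ) ^ lam₂ * ε₂]
        (z₂ - z₁ - 1/2) (-z₂ + 1/4) = 0 := by
  have hN := hW.nonarch
  have hπ0 : ϖ * conj ϖ ≠ 0 :=
    mul_ne_zero hW.unif_ne_zero ((map_ne_zero conj).2 hW.unif_ne_zero)
  have hεU : ε₂ ∈ UE conj absF ∧ absF (ε₂ - 1) < 1 := by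
    rcases hε₂ with rfl | rfl
    · exact ⟨⟨map_one _, hN.map_one⟩, by rw [sub_self, hN.map_zero]; exact one_pos⟩
    · refine ⟨⟨hW.conj_delta hρ.1, hW.abs_delta hρ.2.le⟩, ?_⟩
      rw [add_sub_cancel_left]
      exact hN.mul_lt_one_right hρ.2.le (hW.abs_pi_pow_lt hW.ram_pos.ne')
  obtain ⟨⟨hεc, hε1⟩, hεs⟩ := hεU
  have hε0 := hW.ne_zero_of_abs_eq_one hε1
  obtain ⟨m, hm⟩ := Int.eq_ofNat_of_zero_le (sub_nonneg.2 hlam)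
  have hms : m ≤ s := by omega
  set P := (ϖ * conj ϖ) ^ lam₂ with hP
  have hPc : conj P = P := by rw [hP, map_zpow₀, hW.conj_norm]
  have hP0 : P ≠ 0 := zpow_ne_zero _ hπ0
  have hPabs : 0 < absF P := hN.pos hP0
  have hX : (ϖ * conj ϖ) ^ lam₁ * ε₁ = P * (ϖ * conj ϖ) ^ m := by
    rw [hε₁, mul_one, hP, ← zpow_natCast, ← zpow_add₀ hπ0]
    congr 1; omega
  rw [hX, Lsph_eq_integral hK]
  have hXc : conj (P * (ϖ * conj ϖ) ^ m) = P * (ϖ * conj ϖ) ^ m := by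
    rw [map_mul, hPc, hW.conj_pi_pow]
  have hYc : conj (P * ε₂) = P * ε₂ := by rw [map_mul, hPc, hεc]
  have hXY : P * (ϖ * conj ϖ) ^ m * (P * ε₂) ≠ 0 :=
    mul_ne_zero (mul_ne_zero hP0 (pow_ne_zero _ hπ0)) (mul_ne_zero hP0 hε0)
  by_cases hI : AEStronglyMeasurable (sphericalIntegrand conj absF χstar χ₂
      !![P * (ϖ * conj ϖ) ^ m, 0; 0, P * ε₂] (z₂ - z₁ - 1/2) (-z₂ + 1/4)) μK
  swap
  · exact integral_non_aestronglyMeasurable hI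
  have hnull : NullMeasurableSet {k | k ∈ KSet absF ∧ absF ((ϖ * conj ϖ) ^ m *
      (k 0 0 * conj (k 0 0)) + ε₂ * (k 0 1 * conj (k 0 1))) < 1} μK := by
    set C := absF (P * (ϖ * conj ϖ) ^ m * (P * ε₂)) ^ (-z₂ + 1/4).re with hC
    have hC0 : 0 < C := Real.rpow_pos_of_pos (hN.pos hXY) _
    refine (hI.norm.aemeasurable.nullMeasurableSet_preimage
      (measurableSet_Iio (a := absF P ^ (z₂ - z₁ - 1/2).re * C))).congr ?_
    filter_upwards [hK.ae_mem] with k hk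
    refine propext ?_
    change ‖sphericalIntegrand _ _ _ _ _ _ _ k‖ < _ ↔ (k ∈ KSet absF ∧ _)
    rw [hW.norm_sphericalIntegrand hχs hχ₂ hXc hYc hXY hz₁ hz₂ hk, ← hC,
      mul_lt_mul_iff_left₀ hC0, Real.rpow_lt_rpow_iff (hW.abs_nonneg _) (hW.abs_nonneg _) hz₁,
      mul_assoc, mul_assoc, ← mul_add, hW.abs_mul, mul_lt_iff_lt_one_right hPabs]
    exact (and_iff_right hk).symm
  have hfin : Finite hW.nonarch.Residue := by
    by_cases hm0 : m = 0
    · refine hK.finite_residue_of_sub hN (hnull.congr (Filter.Eventually.of_forall fun k => ?_))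
      refine propext (and_congr_right fun hk => ?_)
      rw [hm0, pow_zero, one_mul]
      exact hW.abs_form_lt_one_iff_sub hρ hΔ hχs hεs (hk.1 0 0) (hk.1 0 1)
    · refine hK.finite_residue hN (hnull.congr (Filter.Eventually.of_forall fun k => ?_))
      exact propext (and_congr_right fun hk => hW.abs_form_lt_one_iff hε1 hm0 (hk.1 0 0))
  obtain ⟨r, hr, hrχ⟩ := hW.exists_char_eq_neg_one hρ hΔ hχs hfin ⟨hεc, hε1⟩
  set c := 1 + r * conj r * (ϖ * conj ϖ) ^ s / ε₂ with hc
  have hcc : conj c = c := by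
    rw [hc, map_add, map_div₀, map_mul, hW.conj_norm, hW.conj_pi_pow, hεc, map_one]
  have hc1 : absF c = 1 := hW.abs_one_add (by
    rw [hN.map_div, hε1, div_one]
    exact hN.mul_lt_one_right (hN.mul_le_one hr (by rwa [hW.conj_abs]))
      (hW.abs_pi_pow_lt hW.ram_pos.ne'))
  set u := r * ϖ ^ (s - m) with hu
  have hu1 : absF u ≤ 1 := hN.mul_le_one hr (by
    rw [hN.map_pow]; exact pow_le_one₀ hW.unif_pos.le hW.unif_lt_one.le)
  set b := -((ϖ * conj ϖ) ^ m * conj u / ε₂) with hb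
  have hb1 : absF b ≤ 1 := by
    rw [hb, hN.map_neg, hN.map_div, hε1, div_one]
    refine hN.mul_le_one ?_ (by rwa [hW.conj_abs])
    rw [hW.abs_pi_pow]
    exact pow_le_one₀ (pow_nonneg hW.unif_pos.le _)
      (pow_le_one₀ hW.unif_pos.le hW.unif_lt_one.le)
  have hbc : conj b = -((ϖ * conj ϖ) ^ m * u / ε₂) := by
    rw [hb, map_neg, map_div₀, map_mul, hW.conj_pi_pow, hW.conj_invol, hεc]
  have hcu : c = 1 + (ϖ * conj ϖ) ^ m * (u * conj u) / ε₂ := by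
    have : (ϖ * conj ϖ) ^ s = (ϖ * conj ϖ) ^ m * (ϖ ^ (s - m) * conj ϖ ^ (s - m)) := by
      rw [← mul_pow, ← pow_add, Nat.add_sub_cancel' hms]
    rw [hc, hu, this, map_mul, map_pow]; ring
  have hg : !![1, b; u, 1] ∈ KSet absF := by
    refine mem_KSet_of hN.map_one.le hb1 hu1 hN.map_one.le ?_
    rw [← hc1, hcu, hb]; congr 1; ring
  refine hK.integral_eq_zero_of_mul_eq_neg hI hg
    (hW.sphericalIntegrand_mul_similitude hχs hχ₂ hXc hYc hcc hc1 hrχ ?_ _ _)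
  refine similitude_action conj ?_ ?_ ?_ ?_
  · rw [hbc, hcu, hb]; field_simp
  · rw [hb]; field_simp; ring
  · rw [hbc]; field_simp; ring
  · rw [hcu]; field_simp; ring
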